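/- arXiv:math/0410522 — 2 statements merged into one kernel-verified Lean document; each statement's English description precedes it below -/
import Mathlib

section
/- There is an absolute constant c > 0 such that for all integers k > 0 and h ≠ 0 and every real x ≥ 2: #{ n ∈ ℤ : 1 ≤ n ≤ x, n ∈ B and kn + h ∈ B } ≤ c · (|h|k/φ(|h|k))² · x/(log x). -/
open Real Filter

/-- `rTwoSquaresZ n` is the number of representations of the integer `n` as a sum of two
squares of integers. -/
noncomputable def rTwoSquaresZ (n : ℤ) : ℕ :=
  {p : ℤ × ℤ | p.1 ^ 2 + p.2 ^ 2 = n}.ncard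

/-- The set of nonnegative integers representable as a sum of two squares. -/
def sumTwoSquaresSet : Set ℤ := {n : ℤ | 0 ≤ n ∧ 0 < rTwoSquaresZ n}

theorem sum_le_sum_of_forall_exists {ι κ : Type*} {s : Finset ι} {t : Finset κ} {f : ι → ℝ}
    {F : κ → ℝ} (φ : κ → ι) (hF : ∀ i ∈ t, 0 ≤ F i)
    (h : ∀ n ∈ s, ∃ i ∈ t, φ i = n ∧ f n ≤ F i) : ∑ n ∈ s, f n ≤ ∑ i ∈ t, F i := by
  classical
  rcases s.eq_empty_or_nonempty with rfl | ⟨n₀, hn₀⟩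
  · simpa using Finset.sum_nonneg hF
  have : Nonempty κ := ⟨(h n₀ hn₀).choose⟩
  choose! g hg using h
  calc ∑ n ∈ s, f n ≤ ∑ n ∈ s, F (g n) := Finset.sum_le_sum fun n hn ↦ (hg n hn).2.2
    _ = ∑ i ∈ s.image g, F i := by
        rw [Finset.sum_image]
        intro a ha b hb hab
        rw [← (hg a ha).2.1, ← (hg b hb).2.1, hab]
    _ ≤ ∑ i ∈ t, F i := by
        refine Finset.sum_le_sum_of_subset_of_nonneg ?_ fun i hi _ ↦ hF i hi
        intro i hi
        obtain ⟨n, hn, rfl⟩ := Finset.mem_image.1 hi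
        exact (hg n hn).1

/-- The integers in `[1, N]` all of whose prime factors are congruent to `r` modulo `4`. -/
def primesModFour (r N : ℕ) : Finset ℕ :=
  {n ∈ Finset.Icc 1 N | ∀ p ∈ n.primeFactors, p % 4 = r}

theorem mem_primesModFour {r N n : ℕ} :
    n ∈ primesModFour r N ↔ 1 ≤ n ∧ n ≤ N ∧ ∀ p, p.Prime → p ∣ n → p % 4 = r := by
  simp only [primesModFour, Finset.mem_filter, Finset.mem_Icc, Nat.mem_primeFactors]
  constructor
  · rintro ⟨⟨h1, h2⟩, h⟩
    exact ⟨h1, h2, fun p hp hd ↦ h p ⟨hp, hd, by omega⟩⟩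
  · rintro ⟨h1, h2, h⟩
    exact ⟨⟨h1, h2⟩, fun p hp ↦ h p hp.1 hp.2.1⟩

theorem mem_primesModFour_of_dvd {r N M m n : ℕ} (hn : n ∈ primesModFour r N) (hm : m ∣ n)
    (hM : m ≤ M) : m ∈ primesModFour r M := by
  rw [mem_primesModFour] at hn ⊢
  exact ⟨Nat.pos_of_dvd_of_pos hm hn.1, hM, fun p hp hd ↦ hn.2.2 p hp (hd.trans hm)⟩

theorem mul_mem_primesModFour {r N M m n : ℕ} (hm : m ∈ primesModFour r M)
    (hn : n ∈ primesModFour r N) : m * n ∈ primesModFour r (M * N) := by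
  rw [mem_primesModFour] at hn hm ⊢
  refine ⟨Nat.mul_pos hm.1 hn.1, Nat.mul_le_mul hm.2.1 hn.2.1, fun p hp hd ↦ ?_⟩
  rcases (Nat.Prime.dvd_mul hp).1 hd with h | h
  · exact hm.2.2 p hp h
  · exact hn.2.2 p hp h

theorem one_mem_primesModFour (r : ℕ) {N : ℕ} (hN : 1 ≤ N) : 1 ∈ primesModFour r N := by
  rw [mem_primesModFour]
  exact ⟨le_rfl, hN, fun q hq hd ↦ absurd (Nat.dvd_one.1 hd) hq.ne_one⟩

theorem exists_mul_eq_primesModFour {n : ℕ} (hn : n % 2 = 1) :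
    ∃ a ∈ primesModFour 1 n, ∃ b ∈ primesModFour 3 n, n = a * b := by
  induction n using Nat.recOnMul with
  | zero => omega
  | one => exact ⟨1, one_mem_primesModFour 1 le_rfl, 1, one_mem_primesModFour 3 le_rfl, rfl⟩
  | prime p hp =>
    have h1 (r : ℕ) : 1 ∈ primesModFour r p := one_mem_primesModFour r hp.one_le
    have h2 : p ∈ primesModFour (p % 4) p := by
      rw [mem_primesModFour]
      exact ⟨hp.one_le, le_rfl, fun q hq hd ↦ by rw [(Nat.prime_dvd_prime_iff_eq hq hp).1 hd]⟩
    rcases (by omega : p % 4 = 1 ∨ p % 4 = 3) with h | h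
    · exact ⟨p, h ▸ h2, 1, h1 3, (mul_one p).symm⟩
    · exact ⟨1, h1 1, p, h ▸ h2, (one_mul p).symm⟩
  | mul m n hm hn' =>
    rw [Nat.mul_mod] at hn
    have hm1 : m % 2 = 1 := by rcases Nat.mod_two_eq_zero_or_one m with h | h <;> simp_all
    have hn1 : n % 2 = 1 := by rcases Nat.mod_two_eq_zero_or_one n with h | h <;> simp_all
    obtain ⟨a, ha, b, hb, hab⟩ := hm hm1
    obtain ⟨c, hc, d, hd, hcd⟩ := hn' hn1
    exact ⟨a * c, mul_mem_primesModFour ha hc, b * d, mul_mem_primesModFour hb hd, by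
      rw [hab, hcd]; ring⟩

theorem log_add_one_le_sum_inv (N : ℕ) :
    Real.log (N + 1) ≤ ∑ n ∈ Finset.Icc 1 N, (n : ℝ)⁻¹ := by
  have h := log_add_one_le_harmonic N
  rw [harmonic_eq_sum_Icc] at h
  push_cast at h
  exact h

theorem sum_inv_le_one_add_log (N : ℕ) :
    ∑ n ∈ Finset.Icc 1 N, (n : ℝ)⁻¹ ≤ 1 + Real.log N := by
  have h := harmonic_le_one_add_log N
  rw [harmonic_eq_sum_Icc] at h
  push_cast at h
  exact h

theorem log_add_one_le_two_mul_sum_odd (N : ℕ) :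
    Real.log (N + 1) ≤ 2 * ∑ n ∈ Finset.Icc 1 N with n % 2 = 1, (n : ℝ)⁻¹ := by
  refine (log_add_one_le_sum_inv N).trans ?_
  rw [← Finset.sum_filter_add_sum_filter_not _ (fun n ↦ n % 2 = 1), two_mul]
  gcongr 1
  refine sum_le_sum_of_forall_exists (fun n ↦ n + 1) (fun i _ ↦ by positivity) fun n hn ↦ ?_
  simp only [Finset.mem_filter, Finset.mem_Icc] at hn
  refine ⟨n - 1, by simp only [Finset.mem_filter, Finset.mem_Icc]; omega, by omega, ?_⟩
  have : 0 < n - 1 := by omega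
  gcongr
  omega

theorem log_add_one_le_two_mul_sum_mul_sum (N : ℕ) :
    Real.log (N + 1) ≤ 2 * ((∑ a ∈ primesModFour 1 N, (a : ℝ)⁻¹) *
      ∑ b ∈ primesModFour 3 N, (b : ℝ)⁻¹) := by
  refine (log_add_one_le_two_mul_sum_odd N).trans ?_
  gcongr 2 * ?_
  rw [Finset.sum_mul_sum, ← Finset.sum_product']
  refine sum_le_sum_of_forall_exists (fun i ↦ i.1 * i.2) (fun i _ ↦ by positivity) fun n hn ↦ ?_
  simp only [Finset.mem_filter, Finset.mem_Icc] at hn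
  obtain ⟨a, ha, b, hb, hab⟩ := exists_mul_eq_primesModFour hn.2
  refine ⟨(a, b), ?_, hab.symm, ?_⟩
  · rw [Finset.mem_product]
    have ha' := (mem_primesModFour.1 ha).2.1
    have hb' := (mem_primesModFour.1 hb).2.1
    exact ⟨mem_primesModFour_of_dvd ha dvd_rfl (by omega),
      mem_primesModFour_of_dvd hb dvd_rfl (by omega)⟩
  · rw [hab]; push_cast; rw [mul_inv]

theorem sum_chi_four_mul_le {a : ℕ → ℝ} (ha : AntitoneOn a (Set.Ici 1)) (m : ℕ) :
    ∑ d ∈ Finset.range (4 * m), (ZMod.χ₄ d : ℝ) * a d ≤ a 1 - a (4 * m + 1) := by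
  induction m with
  | zero => simp
  | succ m ih =>
    rw [show 4 * (m + 1) = 4 * m + 1 + 1 + 1 + 1 by ring]
    simp only [Finset.sum_range_succ]
    have h0 : ZMod.χ₄ ((4 * m : ℕ) : ZMod 4) = 0 := by
      rw [ZMod.χ₄_nat_eq_if_mod_four, if_pos (by omega)]
    have h1 : ZMod.χ₄ ((4 * m + 1 : ℕ) : ZMod 4) = 1 := ZMod.χ₄_nat_one_mod_four (by omega)
    have h2 : ZMod.χ₄ ((4 * m + 1 + 1 : ℕ) : ZMod 4) = 0 := by
      rw [ZMod.χ₄_nat_eq_if_mod_four, if_pos (by omega)]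
    have h3 : ZMod.χ₄ ((4 * m + 1 + 1 + 1 : ℕ) : ZMod 4) = -1 :=
      ZMod.χ₄_nat_three_mod_four (by omega)
    rw [h0, h1, h2, h3]
    have := ha (a := 4 * m + 1 + 1 + 1) (b := 4 * m + 1 + 1 + 1 + 1 + 1) (by simp) (by simp) (by omega)
    push_cast
    linarith

/-- The convolution of `1` with the nontrivial character modulo `4`. -/
noncomputable def divisorSumChiFour (n : ℕ) : ℝ := ∑ d ∈ n.divisors, (ZMod.χ₄ d : ℝ)

theorem divisorSumChiFour_nonneg (n : ℕ) : 0 ≤ divisorSumChiFour n := by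
  let χ : DirichletCharacter ℂ 4 := ZMod.χ₄.ringHomComp (Int.castRingHom ℂ)
  have hχ : χ ^ 2 = 1 := by
    rw [← MulChar.isQuadratic_iff_sq_eq_one]
    exact ZMod.isQuadratic_χ₄.comp _
  have h := DirichletCharacter.zetaMul_nonneg hχ n
  have h2 : DirichletCharacter.zetaMul χ n = ((divisorSumChiFour n : ℝ) : ℂ) := by
    rw [DirichletCharacter.zetaMul, ArithmeticFunction.coe_zeta_mul_apply, divisorSumChiFour]
    push_cast
    refine Finset.sum_congr rfl fun d hd ↦ ?_
    have : d ≠ 0 := (Nat.pos_of_mem_divisors hd).ne'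
    simp [toArithmeticFunction, this, χ]
  rw [h2] at h
  exact_mod_cast h

theorem divisorSumChiFour_eq_card {n N : ℕ} (hn : n ∈ primesModFour 1 N) :
    divisorSumChiFour n = n.divisors.card := by
  have h : ∀ d, d ∣ n → d % 4 = 1 := by
    intro d
    induction d using Nat.recOnMul with
    | zero => intro h; have := (mem_primesModFour.1 hn).1; rw [zero_dvd_iff] at h; omega
    | one => intro _; rfl
    | prime p hp => exact (mem_primesModFour.1 hn).2.2 p hp
    | mul a b iha ihb =>
      intro h
      rw [Nat.mul_mod, iha (dvd_of_mul_right_dvd h), ihb (dvd_of_mul_left_dvd h)]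
  rw [divisorSumChiFour, Finset.card_eq_sum_ones, Nat.cast_sum]
  refine Finset.sum_congr rfl fun d hd ↦ ?_
  rw [ZMod.χ₄_nat_one_mod_four (h d (Nat.dvd_of_mem_divisors hd))]
  simp

theorem sum_divisorSumChiFour_div_le (N : ℕ) :
    ∑ n ∈ Finset.Icc 1 N, divisorSumChiFour n / n ≤ ∑ n ∈ Finset.Icc 1 N, (n : ℝ)⁻¹ := by
  set a : ℕ → ℝ := fun d ↦ (d : ℝ)⁻¹ * ∑ e ∈ Finset.Icc 1 (N / d), (e : ℝ)⁻¹ with ha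
  have hanti : AntitoneOn a (Set.Ici 1) := by
    intro d hd d' hd' hdd
    simp only [Set.mem_Ici] at hd hd'
    simp only [ha]
    gcongr
  have h1 : ∑ n ∈ Finset.Icc 1 N, divisorSumChiFour n / n =
      ∑ d ∈ Finset.Icc 1 N, (ZMod.χ₄ d : ℝ) * a d := by
    simp only [divisorSumChiFour, ha, Finset.sum_div, Finset.mul_sum]
    rw [Finset.sum_sigma', Finset.sum_sigma']
    refine Finset.sum_bij' (fun i _ ↦ ⟨i.2, i.1 / i.2⟩) (fun i _ ↦ ⟨i.1 * i.2, i.1⟩) ?_ ?_ ?_ ?_ ?_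
    · rintro ⟨n, d⟩ h
      simp only [Finset.mem_sigma, Finset.mem_Icc, Nat.mem_divisors] at h ⊢
      obtain ⟨⟨h1, h2⟩, h3, -⟩ := h
      have hd : 0 < d := Nat.pos_of_dvd_of_pos h3 h1
      exact ⟨⟨hd, (Nat.le_of_dvd h1 h3).trans h2⟩, Nat.div_pos (Nat.le_of_dvd h1 h3) hd,
        Nat.div_le_div_right h2⟩
    · rintro ⟨d, e⟩ h
      simp only [Finset.mem_sigma, Finset.mem_Icc, Nat.mem_divisors] at h ⊢
      obtain ⟨⟨h1, h2⟩, h3, h4⟩ := h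
      rw [Nat.le_div_iff_mul_le h1] at h4
      have : 0 < d * e := Nat.mul_pos h1 h3
      exact ⟨⟨this, by rwa [mul_comm]⟩, dvd_mul_right _ _, this.ne'⟩
    · rintro ⟨n, d⟩ h
      simp only [Finset.mem_sigma, Finset.mem_Icc, Nat.mem_divisors] at h ⊢
      simp [Nat.mul_div_cancel' h.2.1]
    · rintro ⟨d, e⟩ h
      simp only [Finset.mem_sigma, Finset.mem_Icc] at h ⊢
      simp [Nat.mul_div_cancel_left e h.1.1]
    · rintro ⟨n, d⟩ h
      simp only [Finset.mem_sigma, Finset.mem_Icc, Nat.mem_divisors] at h ⊢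
      obtain ⟨⟨h1, h2⟩, ⟨e, rfl⟩, -⟩ := h
      have hd : 0 < d := Nat.pos_of_mul_pos_right h1
      rw [Nat.mul_div_cancel_left e hd]
      push_cast
      rw [div_eq_mul_inv, mul_inv]
  have h2 : ∑ d ∈ Finset.Icc 1 N, (ZMod.χ₄ d : ℝ) * a d =
      ∑ d ∈ Finset.range (4 * (N + 1)), (ZMod.χ₄ d : ℝ) * a d := by
    refine Finset.sum_subset (fun d hd ↦ ?_) fun d _ hd ↦ ?_
    · simp only [Finset.mem_Icc, Finset.mem_range] at hd ⊢; omega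
    · rcases Nat.eq_zero_or_pos d with rfl | hd0
      · simp
      · have : N / d = 0 := Nat.div_eq_of_lt (by simp only [Finset.mem_Icc] at hd; omega)
        simp [ha, this]
  rw [h1, h2]
  refine (sum_chi_four_mul_le hanti _).trans ?_
  have h3 : a 1 = ∑ n ∈ Finset.Icc 1 N, (n : ℝ)⁻¹ := by simp [ha]
  have h4 : 0 ≤ a (4 * (N + 1) + 1) := by positivity
  linarith

theorem sq_sum_primesModFour_one_le (N : ℕ) :
    (∑ a ∈ primesModFour 1 N, (a : ℝ)⁻¹) ^ 2 ≤ ∑ n ∈ Finset.Icc 1 (N * N), (n : ℝ)⁻¹ := by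
  refine le_trans ?_ (sum_divisorSumChiFour_div_le (N * N))
  calc (∑ a ∈ primesModFour 1 N, (a : ℝ)⁻¹) ^ 2
      = ∑ i ∈ primesModFour 1 N ×ˢ primesModFour 1 N, ((i.1 : ℝ)⁻¹ * (i.2 : ℝ)⁻¹) := by
        rw [sq, Finset.sum_mul_sum, ← Finset.sum_product']
    _ ≤ ∑ i ∈ (primesModFour 1 (N * N)).sigma fun n ↦ n.divisors, (i.1 : ℝ)⁻¹ := by
        refine sum_le_sum_of_forall_exists (fun i ↦ (i.2, i.1 / i.2))
          (fun i _ ↦ by positivity) ?_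
        rintro ⟨a, b⟩ hi
        simp only [Finset.mem_product] at hi
        have ha := (mem_primesModFour.1 hi.1).1
        have hab := mul_mem_primesModFour hi.1 hi.2
        refine ⟨⟨a * b, a⟩, ?_, ?_, ?_⟩
        · simp only [Finset.mem_sigma, Nat.mem_divisors]
          exact ⟨hab, dvd_mul_right _ _, by have := (mem_primesModFour.1 hab).1; omega⟩
        · simp [Nat.mul_div_cancel_left b ha]
        · simp [mul_comm]
    _ = ∑ n ∈ primesModFour 1 (N * N), divisorSumChiFour n / n := by
        rw [Finset.sum_sigma]
        refine Finset.sum_congr rfl fun n hn ↦ ?_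
        rw [divisorSumChiFour_eq_card hn]
        simp [div_eq_mul_inv]
    _ ≤ ∑ n ∈ Finset.Icc 1 (N * N), divisorSumChiFour n / n := by
        refine Finset.sum_le_sum_of_subset_of_nonneg (Finset.filter_subset _ _) fun n _ _ ↦ ?_
        exact div_nonneg (divisorSumChiFour_nonneg n) (Nat.cast_nonneg n)

theorem sum_inv_sq_le_two (N : ℕ) : ∑ n ∈ Finset.Icc 1 N, ((n : ℝ) ^ 2)⁻¹ ≤ 2 := by
  suffices h : ∑ n ∈ Finset.Icc 1 N, ((n : ℝ) ^ 2)⁻¹ ≤ 2 - ((N : ℝ) + 1 / 2)⁻¹ by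
    have : (0 : ℝ) ≤ ((N : ℝ) + 1 / 2)⁻¹ := by positivity
    linarith
  induction N with
  | zero => norm_num
  | succ N ih =>
    rw [Finset.sum_Icc_succ_top (by omega)]
    have : (((N + 1 : ℕ) : ℝ) ^ 2)⁻¹ ≤ ((N : ℝ) + 1 / 2)⁻¹ - (((N + 1 : ℕ) : ℝ) + 1 / 2)⁻¹ := by
      push_cast
      rw [inv_sub_inv (by positivity) (by positivity), inv_eq_one_div,
        div_le_div_iff₀ (by positivity) (by positivity)]
      nlinarith [(Nat.cast_nonneg N : (0 : ℝ) ≤ N)]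
    linarith

theorem sum_primesModFour_le_two_mul_sum_squarefree (r N : ℕ) :
    ∑ n ∈ primesModFour r N, (n : ℝ)⁻¹ ≤
      2 * ∑ n ∈ primesModFour r N with Squarefree n, (n : ℝ)⁻¹ := by
  calc ∑ n ∈ primesModFour r N, (n : ℝ)⁻¹
      ≤ ∑ i ∈ Finset.Icc 1 N ×ˢ {n ∈ primesModFour r N | Squarefree n},
        ((i.1 : ℝ) ^ 2)⁻¹ * (i.2 : ℝ)⁻¹ := by
        refine sum_le_sum_of_forall_exists (fun i ↦ i.1 ^ 2 * i.2)
          (fun i _ ↦ by positivity) fun n hn ↦ ?_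
        obtain ⟨h1, h2, -⟩ := mem_primesModFour.1 hn
        obtain ⟨a, b, hab, ha⟩ := Nat.sq_mul_squarefree n
        have hb0 : b ≠ 0 := by rintro rfl; simp at hab; omega
        have hd : b ∣ n := ⟨b * a, by rw [← hab]; ring⟩
        have hd' : a ∣ n := ⟨b ^ 2, by rw [← hab]; ring⟩
        refine ⟨(b, a), ?_, hab, ?_⟩
        · simp only [Finset.mem_product, Finset.mem_Icc, Finset.mem_filter]
          exact ⟨⟨by omega, (Nat.le_of_dvd h1 hd).trans h2⟩,
            mem_primesModFour_of_dvd hn hd' ((Nat.le_of_dvd h1 hd').trans h2), ha⟩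
        · rw [← hab]; push_cast; rw [mul_inv]
    _ = (∑ n ∈ Finset.Icc 1 N, ((n : ℝ) ^ 2)⁻¹) *
        ∑ n ∈ primesModFour r N with Squarefree n, (n : ℝ)⁻¹ := by
        rw [Finset.sum_mul_sum, ← Finset.sum_product']
    _ ≤ _ := by
        gcongr
        · exact sum_inv_sq_le_two N

theorem sq_sum_squarefree_le (r N : ℕ) :
    (∑ n ∈ primesModFour r N with Squarefree n, (n : ℝ)⁻¹) ^ 2 ≤
      2 * ∑ n ∈ primesModFour r (N * N) with Squarefree n, (n.divisors.card : ℝ) / n := by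
  set S : Finset ℕ := {n ∈ primesModFour r N | Squarefree n}
  set T : Finset ℕ := {n ∈ primesModFour r (N * N) | Squarefree n}
  calc (∑ n ∈ S, (n : ℝ)⁻¹) ^ 2 = ∑ i ∈ S ×ˢ S, ((i.1 : ℝ)⁻¹ * (i.2 : ℝ)⁻¹) := by
        rw [sq, Finset.sum_mul_sum, ← Finset.sum_product']
    _ ≤ ∑ i ∈ Finset.Icc 1 N ×ˢ T.sigma fun n ↦ n.divisors,
        ((i.1 : ℝ) ^ 2)⁻¹ * (i.2.1 : ℝ)⁻¹ := by
        refine sum_le_sum_of_forall_exists (fun i ↦ (i.1 * i.2.2, i.1 * (i.2.1 / i.2.2)))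
          (fun i _ ↦ by positivity) ?_
        rintro ⟨a, b⟩ hi
        simp only [Finset.mem_product, S, Finset.mem_filter] at hi
        obtain ⟨⟨haN, ha⟩, hbN, hb⟩ := hi
        obtain ⟨ha1, ha2, -⟩ := mem_primesModFour.1 haN
        obtain ⟨hb1, hb2, -⟩ := mem_primesModFour.1 hbN
        obtain ⟨g, a', b', hg, hcop, rfl, rfl⟩ := Nat.exists_coprime' (m := a) (n := b)
          (Nat.gcd_pos_of_pos_left b ha1)
        have ha' : 0 < a' := Nat.pos_of_mul_pos_right ha1
        have hb' : 0 < b' := Nat.pos_of_mul_pos_right hb1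
        refine ⟨⟨g, a' * b', a'⟩, ?_, ?_, ?_⟩
        · simp only [Finset.mem_product, Finset.mem_Icc, Finset.mem_sigma, T, Finset.mem_filter,
            Nat.mem_divisors]
          have hga : a' ≤ a' * g := Nat.le_mul_of_pos_right _ hg
          have hgb : b' ≤ b' * g := Nat.le_mul_of_pos_right _ hg
          refine ⟨⟨hg, (Nat.le_mul_of_pos_left g ha').trans ha2⟩, ⟨?_, ?_⟩, dvd_mul_right _ _,
            (Nat.mul_pos ha' hb').ne'⟩
          · exact mul_mem_primesModFour
              (mem_primesModFour_of_dvd haN (dvd_mul_right _ _) (hga.trans ha2))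
              (mem_primesModFour_of_dvd hbN (dvd_mul_right _ _) (hgb.trans hb2))
          · rw [Nat.squarefree_mul hcop]
            exact ⟨ha.squarefree_of_dvd (dvd_mul_right _ _),
              hb.squarefree_of_dvd (dvd_mul_right _ _)⟩
        · simp [Nat.mul_div_cancel_left b' ha', mul_comm]
        · apply le_of_eq
          push_cast
          simp only [mul_inv]
          ring
    _ = (∑ n ∈ Finset.Icc 1 N, ((n : ℝ) ^ 2)⁻¹) *
        ∑ n ∈ T, (n.divisors.card : ℝ) / n := by
        rw [Finset.sum_product, Finset.sum_mul]
        refine Finset.sum_congr rfl fun n _ ↦ ?_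
        rw [Finset.sum_sigma, Finset.mul_sum]
        refine Finset.sum_congr rfl fun m _ ↦ ?_
        simp only [Finset.sum_const, nsmul_eq_mul]
        ring
    _ ≤ _ := by
        gcongr
        · exact sum_inv_sq_le_two N

theorem log_le_mul_sum_squarefree {N : ℕ} (hN : 1 ≤ N) :
    Real.log (N + 1) ≤ 128 * ∑ n ∈ primesModFour 3 (N * N) with Squarefree n,
      (n.divisors.card : ℝ) / n := by
  set L := Real.log (N + 1)
  set T := ∑ n ∈ primesModFour 3 (N * N) with Squarefree n, (n.divisors.card : ℝ) / n
  set P := ∑ a ∈ primesModFour 1 N, (a : ℝ)⁻¹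
  set Q := ∑ a ∈ primesModFour 3 N, (a : ℝ)⁻¹
  set R := ∑ n ∈ primesModFour 3 N with Squarefree n, (n : ℝ)⁻¹
  have h1 : L ≤ 2 * (P * Q) := log_add_one_le_two_mul_sum_mul_sum N
  have h2 : P ^ 2 ≤ 1 + Real.log ((N * N : ℕ) : ℝ) :=
    (sq_sum_primesModFour_one_le N).trans (sum_inv_le_one_add_log _)
  have h3 : Q ≤ 2 * R := sum_primesModFour_le_two_mul_sum_squarefree 3 N
  have h4 : R ^ 2 ≤ 2 * T := sq_sum_squarefree_le 3 N
  have hN' : (1 : ℝ) ≤ N := by exact_mod_cast hN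
  have h5 : Real.log ((N * N : ℕ) : ℝ) ≤ 2 * L := by
    push_cast
    rw [Real.log_mul (by positivity) (by positivity)]
    have : Real.log N ≤ L := Real.log_le_log (by positivity) (by linarith)
    linarith
  have h6 : 1 / 2 ≤ L := by
    have : Real.log 2 ≤ L := Real.log_le_log (by positivity) (by linarith)
    have := Real.log_two_gt_d9
    linarith
  have hP : 0 ≤ P := Finset.sum_nonneg fun _ _ ↦ by positivity
  have hQ : 0 ≤ Q := Finset.sum_nonneg fun _ _ ↦ by positivity
  have h7 : L ^ 2 ≤ (4 * L) * (32 * T) := by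
    calc L ^ 2 ≤ (2 * (P * Q)) ^ 2 := by gcongr
      _ = P ^ 2 * (4 * Q ^ 2) := by ring
      _ ≤ (4 * L) * (4 * (2 * R) ^ 2) := by gcongr; linarith
      _ = (4 * L) * (16 * R ^ 2) := by ring
      _ ≤ (4 * L) * (32 * T) := by gcongr ?_ * ?_; linarith
  have h8 : L * L ≤ L * (128 * T) := by linarith
  exact le_of_mul_le_mul_left h8 (by linarith)

theorem card_divisors_div_eq_prod {n : ℕ} (hn : Squarefree n) :
    (n.divisors.card : ℝ) / n = ∏ p ∈ n.primeFactors, (2 / p : ℝ) := by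
  rw [Finset.prod_div_distrib, Finset.prod_const, Nat.card_divisors hn.ne_zero]
  have h1 : ∏ p ∈ n.primeFactors, (n.factorization p + 1) = 2 ^ n.primeFactors.card := by
    rw [← Finset.prod_const]
    refine Finset.prod_congr rfl fun p hp ↦ ?_
    rw [Nat.mem_primeFactors] at hp
    rw [Nat.factorization_eq_one_of_squarefree hn hp.1 hp.2.1]
  rw [h1]
  conv_lhs => rw [← Nat.prod_primeFactors_of_squarefree hn]
  rw [Nat.primeFactors_prod fun p hp ↦ Nat.prime_of_mem_primeFactors hp]
  push_cast
  rfl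

/-- The squarefree integers in `[1, D]` that are coprime to `m` and whose prime factors are all
congruent to `3` modulo `4`. -/
def sieveModuli (m D : ℕ) : Finset ℕ := {n ∈ primesModFour 3 D | Squarefree n ∧ n.Coprime m}

theorem prod_one_add_two_div_le (m : ℕ) (hm : m ≠ 0) :
    ∏ p ∈ m.primeFactors, (1 + 2 / p : ℝ) ≤ ((m : ℝ) / m.totient) ^ 2 := by
  have hφ : (m.totient : ℝ) = m * ∏ p ∈ m.primeFactors, (1 - (p : ℝ)⁻¹) := by
    have := congrArg (fun q : ℚ ↦ (q : ℝ)) (Nat.totient_eq_mul_prod_factors m)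
    push_cast at this
    exact this
  have hm' : (m : ℝ) ≠ 0 := by exact_mod_cast hm
  rw [hφ, div_mul_cancel_left₀ hm', ← Finset.prod_inv_distrib, ← Finset.prod_pow]
  refine Finset.prod_le_prod (fun p _ ↦ by positivity) fun p hp ↦ ?_
  have hp2 : (2 : ℝ) ≤ p := by exact_mod_cast (Nat.prime_of_mem_primeFactors hp).two_le
  have h1 : (1 + (p : ℝ)⁻¹) ≤ (1 - (p : ℝ)⁻¹)⁻¹ := by
    have : (p : ℝ)⁻¹ ≤ 2⁻¹ := inv_anti₀ (by norm_num) hp2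
    rw [← one_div (1 - (p : ℝ)⁻¹), le_div_iff₀ (by linarith)]
    nlinarith [sq_nonneg (p : ℝ)⁻¹]
  calc (1 + 2 / p : ℝ) ≤ (1 + (p : ℝ)⁻¹) ^ 2 := by
        rw [div_eq_mul_inv]; nlinarith [sq_nonneg (p : ℝ)⁻¹]
    _ ≤ _ := by gcongr

theorem sum_squarefree_le_mul_sum_sieveModuli (m D : ℕ) (hm : m ≠ 0) :
    ∑ n ∈ primesModFour 3 D with Squarefree n, (n.divisors.card : ℝ) / n ≤
      ((m : ℝ) / m.totient) ^ 2 * ∑ n ∈ sieveModuli m D, ∏ p ∈ n.primeFactors, (2 / p : ℝ) := by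
  calc ∑ n ∈ primesModFour 3 D with Squarefree n, (n.divisors.card : ℝ) / n
      ≤ ∑ i ∈ m.primeFactors.powerset ×ˢ sieveModuli m D,
          (∏ p ∈ i.1, (2 / p : ℝ)) * ∏ p ∈ i.2.primeFactors, (2 / p : ℝ) := by
        refine sum_le_sum_of_forall_exists (fun i ↦ (∏ p ∈ i.1, p) * i.2)
          (fun i _ ↦ by positivity) fun n hn ↦ ?_
        simp only [Finset.mem_filter] at hn
        obtain ⟨hnD, hn⟩ := hn
        set s := n.primeFactors ∩ m.primeFactors
        set t := n.primeFactors \ m.primeFactors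
        have htp : ∀ p ∈ t, p.Prime := fun p hp ↦
          Nat.prime_of_mem_primeFactors (Finset.mem_sdiff.1 hp).1
        have hst : (∏ p ∈ s, p) * ∏ p ∈ t, p = n := by
          rw [Finset.prod_inter_mul_prod_sdiff, Nat.prod_primeFactors_of_squarefree hn]
        have htn : (∏ p ∈ t, p) ∣ n := ⟨∏ p ∈ s, p, by rw [mul_comm, hst]⟩
        have hn1 := mem_primesModFour.1 hnD
        refine ⟨(s, ∏ p ∈ t, p), ?_, hst, ?_⟩
        · rw [Finset.mem_product, Finset.mem_powerset, sieveModuli, Finset.mem_filter]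
          refine ⟨Finset.inter_subset_right, mem_primesModFour_of_dvd hnD htn
            ((Nat.le_of_dvd hn1.1 htn).trans hn1.2.1), hn.squarefree_of_dvd htn, ?_⟩
          change (∏ p ∈ t, p).Coprime m
          refine Nat.Coprime.prod_left fun p hp ↦ ?_
          rw [(htp p hp).coprime_iff_not_dvd]
          intro hpm
          exact (Finset.mem_sdiff.1 hp).2 (Nat.mem_primeFactors.2 ⟨htp p hp, hpm, hm⟩)
        · simp only
          rw [card_divisors_div_eq_prod hn, Nat.primeFactors_prod htp,
            Finset.prod_inter_mul_prod_sdiff]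
    _ = (∏ p ∈ m.primeFactors, (1 + 2 / p : ℝ)) *
          ∑ n ∈ sieveModuli m D, ∏ p ∈ n.primeFactors, (2 / p : ℝ) := by
        rw [Finset.prod_one_add, Finset.sum_mul_sum, ← Finset.sum_product']
    _ ≤ _ := by
        gcongr
        exact prod_one_add_two_div_le m hm

theorem sum_range_mul_of_periodic {a b : ℕ} (hab : a.Coprime b) (ha : a ≠ 0) (hb : b ≠ 0)
    {f g : ℕ → ℝ} (hf : Function.Periodic f a) (hg : Function.Periodic g b) :
    ∑ n ∈ Finset.range (a * b), f n * g n =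
      (∑ n ∈ Finset.range a, f n) * ∑ n ∈ Finset.range b, g n := by
  rw [Finset.sum_mul_sum, ← Finset.sum_product']
  refine Finset.sum_bij' (fun n _ ↦ (n % a, n % b))
    (fun i _ ↦ (Nat.chineseRemainder hab i.1 i.2 : ℕ)) ?_ ?_ ?_ ?_ ?_
  · intro n _
    simp [Nat.mod_lt, Nat.pos_of_ne_zero ha, Nat.pos_of_ne_zero hb]
  · intro i _
    exact Finset.mem_range.2 (Nat.chineseRemainder_lt_mul hab i.1 i.2 ha hb)
  · intro n hn
    have h := Nat.chineseRemainder_modEq_unique hab (a := n % a) (b := n % b) (z := n)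
      (Nat.mod_modEq n a).symm (Nat.mod_modEq n b).symm
    exact (Nat.ModEq.eq_of_lt_of_lt h (Finset.mem_range.1 hn)
      (Nat.chineseRemainder_lt_mul hab _ _ ha hb)).symm
  · rintro ⟨i, j⟩ hij
    simp only [Finset.mem_product, Finset.mem_range] at hij
    have h := (Nat.chineseRemainder hab i j).2
    exact Prod.ext (Eq.trans h.1 (Nat.mod_eq_of_lt hij.1))
      (Eq.trans h.2 (Nat.mod_eq_of_lt hij.2))
  · intro n _
    rw [hf.map_mod_nat, hg.map_mod_nat]

theorem periodic_of_dvd {f : ℕ → ℝ} {a b : ℕ} (hf : Function.Periodic f a) (hab : a ∣ b) :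
    Function.Periodic f b := by
  obtain ⟨c, rfl⟩ := hab
  intro n
  rw [mul_comm]
  exact_mod_cast hf.nat_mul c n

theorem periodic_prod {s : Finset ℕ} {q : ℕ → ℕ} {f : ℕ → ℕ → ℝ}
    (hf : ∀ i ∈ s, Function.Periodic (f i) (q i)) :
    Function.Periodic (fun n ↦ ∏ i ∈ s, f i n) (∏ i ∈ s, q i) := fun n ↦
  Finset.prod_congr rfl fun i hi ↦ periodic_of_dvd (hf i hi) (Finset.dvd_prod_of_mem q hi) n

theorem sum_range_prod_of_periodic {s : Finset ℕ} {q : ℕ → ℕ} {f : ℕ → ℕ → ℝ}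
    (hq : ∀ i ∈ s, q i ≠ 0) (hcop : (s : Set ℕ).Pairwise fun i j ↦ (q i).Coprime (q j))
    (hf : ∀ i ∈ s, Function.Periodic (f i) (q i)) :
    ∑ n ∈ Finset.range (∏ i ∈ s, q i), ∏ i ∈ s, f i n =
      ∏ i ∈ s, ∑ n ∈ Finset.range (q i), f i n := by
  induction s using Finset.induction_on with
  | empty => simp
  | insert a s has ih =>
    simp only [Finset.prod_insert has]
    have hs : ∀ i ∈ s, i ∈ insert a s := fun i hi ↦ Finset.mem_insert_of_mem hi
    rw [sum_range_mul_of_periodic (f := f a) (g := fun n ↦ ∏ i ∈ s, f i n) ?_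
      (hq a (Finset.mem_insert_self a s)) (Finset.prod_ne_zero_iff.2 fun i hi ↦ hq i (hs i hi))
      (hf a (Finset.mem_insert_self a s)) (periodic_prod fun i hi ↦ hf i (hs i hi)),
      ih (fun i hi ↦ hq i (hs i hi)) (hcop.mono (by simp)) fun i hi ↦ hf i (hs i hi)]
    refine Nat.Coprime.prod_right fun i hi ↦ ?_
    exact hcop (by simp) (by simp [hi]) (by rintro rfl; exact has hi)

theorem sum_range_le_of_periodic {f : ℕ → ℝ} {M : ℕ} (hM : 0 < M) (hf : Function.Periodic f M)
    (h1 : ∀ n, f n ≤ 1) {μ : ℝ} (hμ : 0 ≤ μ) (hsum : ∑ n ∈ Finset.range M, f n = M * μ) (N : ℕ) :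
    ∑ n ∈ Finset.range N, f n ≤ N * μ + M := by
  have hmul (q : ℕ) : ∑ n ∈ Finset.range (M * q), f n = (M * q : ℕ) * μ := by
    induction q with
    | zero => simp
    | succ q ih =>
      rw [mul_add, mul_one, Finset.sum_range_add, ih]
      have (n : ℕ) : f (M * q + n) = f n := by
        rw [add_comm, periodic_of_dvd hf (dvd_mul_right M q)]
      simp only [this, hsum]
      push_cast
      ring
  conv_lhs => rw [← Nat.div_add_mod N M]
  rw [Finset.sum_range_add, hmul]
  have h2 : ∑ n ∈ Finset.range (N % M), f (M * (N / M) + n) ≤ M := by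
    calc _ ≤ ∑ n ∈ Finset.range (N % M), (1 : ℝ) := Finset.sum_le_sum fun n _ ↦ h1 _
      _ = (N % M : ℕ) := by simp
      _ ≤ M := by exact_mod_cast (Nat.mod_lt N hM).le
  have h3 : ((M * (N / M) : ℕ) : ℝ) ≤ N := by exact_mod_cast Nat.mul_div_le N M
  gcongr

/-- The prime `p` divides `z` exactly once. -/
def ExactlyDvd (p : ℕ) (z : ℤ) : Prop := (p : ℤ) ∣ z ∧ ¬ (p : ℤ) ^ 2 ∣ z

theorem exactlyDvd_iff {p : ℕ} (hp : p.Prime) (z : ℤ) :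
    ExactlyDvd p z ↔ (p : ZMod (p ^ 2)) * z = 0 ∧ (z : ZMod (p ^ 2)) ≠ 0 := by
  have hp0 : (p : ℤ) ≠ 0 := by exact_mod_cast hp.ne_zero
  rw [ExactlyDvd, Ne, ZMod.intCast_zmod_eq_zero_iff_dvd]
  have h : (p : ZMod (p ^ 2)) * z = ((p * z : ℤ) : ZMod (p ^ 2)) := by push_cast; rfl
  rw [h, ZMod.intCast_zmod_eq_zero_iff_dvd]
  push_cast
  rw [sq, mul_dvd_mul_iff_left hp0]

theorem not_exactlyDvd_of_mem {p : ℕ} (hp : p.Prime) (hp3 : p % 4 = 3) {z : ℤ}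
    (hz : z ∈ sumTwoSquaresSet) : ¬ ExactlyDvd p z := by
  rintro ⟨h1, h2⟩
  have hne : {q : ℤ × ℤ | q.1 ^ 2 + q.2 ^ 2 = z}.Nonempty := by
    refine Set.nonempty_of_ncard_ne_zero ?_
    exact hz.2.ne'
  obtain ⟨⟨a, b⟩, hab⟩ := hne
  simp only [Set.mem_ofPred_eq] at hab
  have : Fact p.Prime := ⟨hp⟩
  have h0 : (a : ZMod p) ^ 2 + (b : ZMod p) ^ 2 = 0 := by
    have := (ZMod.intCast_zmod_eq_zero_iff_dvd z p).2 h1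
    rw [← hab] at this
    exact_mod_cast this
  have hb : (b : ZMod p) = 0 := by
    by_contra hb
    refine ZMod.mod_four_ne_three_of_sq_eq_neg_sq' hb (x := (a : ZMod p)) ?_ hp3
    linear_combination h0
  have ha : (a : ZMod p) = 0 := by
    rw [hb] at h0
    simpa using h0
  rw [ZMod.intCast_zmod_eq_zero_iff_dvd] at ha hb
  refine h2 (hab ▸ dvd_add (pow_dvd_pow_of_dvd ha 2) (pow_dvd_pow_of_dvd hb 2))

theorem card_zmod_sq_filter {p : ℕ} (hp : p.Prime) [NeZero (p ^ 2)] :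
    (Finset.univ.filter fun z : ZMod (p ^ 2) ↦ (p : ZMod (p ^ 2)) * z = 0 ∧ z ≠ 0).card = p - 1 := by
  have h : (Finset.univ.filter fun z : ZMod (p ^ 2) ↦ (p : ZMod (p ^ 2)) * z = 0 ∧ z ≠ 0) =
      (Finset.Ico 1 p).image fun j ↦ ((p * j : ℕ) : ZMod (p ^ 2)) := by
    ext z
    simp only [Finset.mem_filter, Finset.mem_univ, true_and, Finset.mem_image, Finset.mem_Ico]
    constructor
    · rintro ⟨h1, h2⟩
      obtain ⟨n, hn, rfl⟩ : ∃ n : ℕ, n < p ^ 2 ∧ (n : ZMod (p ^ 2)) = z :=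
        ⟨z.val, ZMod.val_lt z, ZMod.natCast_zmod_val z⟩
      rw [← Nat.cast_mul, ZMod.natCast_eq_zero_iff, sq, mul_dvd_mul_iff_left hp.ne_zero] at h1
      obtain ⟨j, rfl⟩ := h1
      refine ⟨j, ⟨Nat.one_le_iff_ne_zero.2 ?_, ?_⟩, rfl⟩
      · rintro rfl
        simp at h2
      · rw [sq] at hn
        exact lt_of_mul_lt_mul_left hn (Nat.zero_le p)
    · rintro ⟨j, ⟨hj1, hj2⟩, rfl⟩
      rw [← Nat.cast_mul, Ne, ZMod.natCast_eq_zero_iff, ZMod.natCast_eq_zero_iff, sq,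
        mul_dvd_mul_iff_left hp.ne_zero, mul_dvd_mul_iff_left hp.ne_zero]
      exact ⟨dvd_mul_right _ _, Nat.not_dvd_of_pos_of_lt hj1 hj2⟩
  rw [h, Finset.card_image_of_injOn, Nat.card_Ico]
  intro i hi j hj hij
  simp only [Finset.coe_Ico, Set.mem_Ico] at hi hj
  simp only [ZMod.natCast_eq_natCast_iff] at hij
  have := Nat.ModEq.eq_of_lt_of_lt hij (by nlinarith) (by nlinarith)
  exact Nat.eq_of_mul_eq_mul_left hp.pos this

/-- The residue classes removed by the sieve at the prime `p`. -/
def Removed (k h : ℤ) (p n : ℕ) : Prop := ExactlyDvd p n ∨ ExactlyDvd p (k * n + h)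

open Classical in
theorem card_removed {k h : ℤ} {p : ℕ} (hp : p.Prime) (hk : ¬ (p : ℤ) ∣ k) (hh : ¬ (p : ℤ) ∣ h) :
    ((Finset.range (p ^ 2)).filter (Removed k h p)).card = 2 * (p - 1) := by
  have : NeZero (p ^ 2) := ⟨pow_ne_zero 2 hp.ne_zero⟩
  set E : ZMod (p ^ 2) → Prop := fun z ↦ (p : ZMod (p ^ 2)) * z = 0 ∧ z ≠ 0
  have hE : (Finset.univ.filter E).card = p - 1 := card_zmod_sq_filter hp
  have hku : IsUnit (k : ZMod (p ^ 2)) := by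
    rw [ZMod.coe_int_isUnit_iff_isCoprime]
    push_cast
    refine IsCoprime.pow_left ?_
    exact ((Nat.prime_iff_prime_int.1 hp).coprime_iff_not_dvd).2 hk
  have hbij : Function.Bijective fun z : ZMod (p ^ 2) ↦ (k : ZMod (p ^ 2)) * z + (h : ZMod (p ^ 2)) := by
    rw [← Finite.injective_iff_bijective]
    intro a b hab
    exact hku.mul_left_cancel (add_right_cancel hab)
  have hE2 : (Finset.univ.filter fun z : ZMod (p ^ 2) ↦ E ((k : ZMod (p ^ 2)) * z + (h : ZMod (p ^ 2)))).card = p - 1 := by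
    rw [← hE]
    exact Finset.card_equiv (Equiv.ofBijective _ hbij) (by simp)
  have hdis : Disjoint (Finset.univ.filter E) (Finset.univ.filter fun z : ZMod (p ^ 2) ↦ E ((k : ZMod (p ^ 2)) * z + (h : ZMod (p ^ 2)))) := by
    rw [Finset.disjoint_filter]
    rintro z - ⟨h1, -⟩ ⟨h2, -⟩
    apply hh
    have h3 : ((p * h : ℤ) : ZMod (p ^ 2)) = 0 := by
      push_cast
      linear_combination h2 - k * h1
    rw [ZMod.intCast_zmod_eq_zero_iff_dvd] at h3
    push_cast at h3
    rwa [sq, mul_dvd_mul_iff_left (by exact_mod_cast hp.ne_zero)] at h3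
  rw [two_mul]
  nth_rewrite 1 [← hE]
  rw [← hE2, ← Finset.card_union_of_disjoint hdis]
  refine Finset.card_bij (fun n _ ↦ (n : ZMod (p ^ 2))) ?_ ?_ ?_
  · intro n hn
    rw [Finset.mem_filter, Removed, exactlyDvd_iff hp, exactlyDvd_iff hp] at hn
    push_cast at hn
    rw [← Finset.filter_or, Finset.mem_filter]
    exact ⟨Finset.mem_univ _, hn.2⟩
  · intro a ha b hb hab
    simp only [Finset.mem_filter, Finset.mem_range] at ha hb
    rw [ZMod.natCast_eq_natCast_iff] at hab
    exact Nat.ModEq.eq_of_lt_of_lt hab ha.1 hb.1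
  · intro z hz
    rw [← Finset.filter_or, Finset.mem_filter] at hz
    refine ⟨z.val, ?_, ZMod.natCast_zmod_val z⟩
    rw [Finset.mem_filter, Removed, exactlyDvd_iff hp, exactlyDvd_iff hp]
    push_cast
    rw [ZMod.natCast_zmod_val z]
    exact ⟨Finset.mem_range.2 (ZMod.val_lt z), hz.2⟩

/-- The ratio of the densities of the removed and of the remaining residue classes modulo `p ^ 2`,
when `2 * (p - 1)` classes are removed. -/
noncomputable def sieveDensity (p : ℕ) : ℝ := 2 * (p - 1) / ((p : ℝ) ^ 2 - 2 * p + 2)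

theorem sieveDensity_denom_pos (p : ℕ) : 0 < (p : ℝ) ^ 2 - 2 * p + 2 := by
  nlinarith [sq_nonneg ((p : ℝ) - 1)]

theorem sieveDensity_le_one (p : ℕ) : sieveDensity p ≤ 1 := by
  rw [sieveDensity, div_le_one (sieveDensity_denom_pos p)]
  nlinarith [sq_nonneg ((p : ℝ) - 2)]

theorem two_div_le_sieveDensity {p : ℕ} (hp : 2 ≤ p) : (2 / p : ℝ) ≤ sieveDensity p := by
  have hp' : (2 : ℝ) ≤ p := by exact_mod_cast hp
  rw [sieveDensity, div_le_div_iff₀ (by linarith) (sieveDensity_denom_pos p)]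
  nlinarith

open Classical in
/-- The sieve weight at `p`: it has mean `0` and is constant on the remaining classes. -/
noncomputable def sieveWeight (k h : ℤ) (p n : ℕ) : ℝ :=
  if Removed k h p n then -1 else sieveDensity p

theorem abs_sieveWeight_le_one (k h : ℤ) {p : ℕ} (hp : 2 ≤ p) (n : ℕ) :
    |sieveWeight k h p n| ≤ 1 := by
  have h0 : (0 : ℝ) ≤ sieveDensity p := le_trans (by positivity) (two_div_le_sieveDensity hp)
  rw [sieveWeight]
  split_ifs
  · simp
  · rw [abs_of_nonneg h0]
    exact sieveDensity_le_one p

theorem exactlyDvd_add_mul (p : ℕ) (z t : ℤ) :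
    ExactlyDvd p (z + (p : ℤ) ^ 2 * t) ↔ ExactlyDvd p z := by
  rw [ExactlyDvd, ExactlyDvd, dvd_add_left (dvd_mul_right _ _),
    dvd_add_left ((dvd_pow_self (p : ℤ) two_ne_zero).mul_right t)]

open Classical in
theorem periodic_sieveWeight (k h : ℤ) (p : ℕ) :
    Function.Periodic (sieveWeight k h p) (p ^ 2) := by
  intro n
  have : Removed k h p (n + p ^ 2) ↔ Removed k h p n := by
    rw [Removed, Removed]
    push_cast
    rw [show (n : ℤ) + (p : ℤ) ^ 2 = n + (p : ℤ) ^ 2 * 1 by ring,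
      show k * ((n : ℤ) + (p : ℤ) ^ 2 * 1) + h = k * n + h + (p : ℤ) ^ 2 * k by ring,
      exactlyDvd_add_mul, exactlyDvd_add_mul]
  rw [sieveWeight, sieveWeight]
  exact if_congr this rfl rfl

open Classical in
theorem sum_range_ite_removed {k h : ℤ} {p : ℕ} (hp : p.Prime) (hk : ¬ (p : ℤ) ∣ k)
    (hh : ¬ (p : ℤ) ∣ h) (a b : ℝ) :
    ∑ n ∈ Finset.range (p ^ 2), (if Removed k h p n then a else b) =
      2 * (p - 1) * a + ((p : ℝ) ^ 2 - 2 * p + 2) * b := by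
  have h1 := card_removed hp hk hh
  have h2 := Finset.card_filter_add_card_filter_not (s := Finset.range (p ^ 2)) (Removed k h p)
  rw [Finset.card_range] at h2
  have h3 : (((Finset.range (p ^ 2)).filter (Removed k h p)).card : ℝ) = 2 * (p - 1) := by
    rw [h1]
    push_cast [Nat.cast_sub hp.one_le]
    ring
  have h4 : (((Finset.range (p ^ 2)).filter fun n ↦ ¬ Removed k h p n).card : ℝ) =
      (p : ℝ) ^ 2 - 2 * p + 2 := by
    have := congrArg (fun n : ℕ ↦ (n : ℝ)) h2
    push_cast at this
    linarith
  rw [Finset.sum_ite, Finset.sum_const, Finset.sum_const, nsmul_eq_mul, nsmul_eq_mul, h3, h4]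

theorem sum_range_sieveWeight {k h : ℤ} {p : ℕ} (hp : p.Prime) (hk : ¬ (p : ℤ) ∣ k)
    (hh : ¬ (p : ℤ) ∣ h) : ∑ n ∈ Finset.range (p ^ 2), sieveWeight k h p n = 0 := by
  simp only [sieveWeight]
  rw [sum_range_ite_removed hp hk hh, sieveDensity, mul_div_cancel₀ _ (sieveDensity_denom_pos p).ne']
  ring

theorem sum_range_sieveWeight_sq {k h : ℤ} {p : ℕ} (hp : p.Prime) (hk : ¬ (p : ℤ) ∣ k)
    (hh : ¬ (p : ℤ) ∣ h) :
    ∑ n ∈ Finset.range (p ^ 2), sieveWeight k h p n ^ 2 = (p : ℝ) ^ 2 * sieveDensity p := by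
  simp only [sieveWeight, ite_pow]
  rw [sum_range_ite_removed hp hk hh, sieveDensity]
  have hq := (sieveDensity_denom_pos p).ne'
  have hpq : (p : ℝ) ^ 2 = ((p : ℝ) ^ 2 - 2 * p + 2) + 2 * (p - 1) := by ring
  rw [hpq]
  generalize (p : ℝ) ^ 2 - 2 * p + 2 = q at hq ⊢
  have : q + 2 * (p - 1) - 2 * p + 2 = q := by ring
  rw [this]
  field_simp

theorem sum_range_prod_mul_prod_sieveWeight_le {k h : ℤ} {d e : ℕ} (hd : Squarefree d)
    (he : Squarefree e) (hdp : ∀ p ∈ d.primeFactors, ¬ (p : ℤ) ∣ k ∧ ¬ (p : ℤ) ∣ h)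
    (hep : ∀ p ∈ e.primeFactors, ¬ (p : ℤ) ∣ k ∧ ¬ (p : ℤ) ∣ h) (N : ℕ) :
    ∑ n ∈ Finset.range N, (∏ p ∈ d.primeFactors, sieveWeight k h p n) *
        ∏ p ∈ e.primeFactors, sieveWeight k h p n ≤
      (if d = e then N * ∏ p ∈ d.primeFactors, sieveDensity p else 0) + ((d * e : ℕ) : ℝ) ^ 2 := by
  set s := d.primeFactors ∪ e.primeFactors with hs
  set f : ℕ → ℕ → ℝ := fun p n ↦ (if p ∈ d.primeFactors then sieveWeight k h p n else 1) *
    (if p ∈ e.primeFactors then sieveWeight k h p n else 1) with hf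
  have hsp : ∀ p ∈ s, p.Prime := fun p hp ↦ by
    rcases Finset.mem_union.1 hp with h | h <;> exact Nat.prime_of_mem_primeFactors h
  have hskh : ∀ p ∈ s, ¬ (p : ℤ) ∣ k ∧ ¬ (p : ℤ) ∣ h := fun p hp ↦ by
    rcases Finset.mem_union.1 hp with h | h
    exacts [hdp p h, hep p h]
  have hprod (n : ℕ) : (∏ p ∈ d.primeFactors, sieveWeight k h p n) *
      ∏ p ∈ e.primeFactors, sieveWeight k h p n = ∏ p ∈ s, f p n := by
    rw [hf, Finset.prod_mul_distrib, Finset.prod_ite_mem, Finset.prod_ite_mem,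
      Finset.inter_eq_right.2 Finset.subset_union_left,
      Finset.inter_eq_right.2 Finset.subset_union_right]
  have hper : ∀ p ∈ s, Function.Periodic (f p) (p ^ 2) := fun p _ n ↦ by
    simp only [hf, periodic_sieveWeight k h p n]
  have habs : ∀ p ∈ s, ∀ n, |f p n| ≤ 1 := fun p hp n ↦ by
    have h1 := abs_sieveWeight_le_one k h (hsp p hp).two_le n
    simp only [hf, abs_mul]
    refine mul_le_one₀ ?_ (abs_nonneg _) ?_ <;> split_ifs <;> simp [h1]
  have hM : 0 < ∏ p ∈ s, p ^ 2 := Finset.prod_pos fun p hp ↦ pow_pos (hsp p hp).pos 2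
  have hMle : ∏ p ∈ s, p ^ 2 ≤ (d * e) ^ 2 := by
    rw [Finset.prod_pow]
    refine Nat.pow_le_pow_left ?_ 2
    have h := Finset.prod_union_inter (s₁ := d.primeFactors) (s₂ := e.primeFactors)
      (f := fun p ↦ p)
    rw [Nat.prod_primeFactors_of_squarefree hd, Nat.prod_primeFactors_of_squarefree he] at h
    rw [← h]
    exact Nat.le_mul_of_pos_right _ (Finset.prod_pos fun p hp ↦
      (Nat.prime_of_mem_primeFactors (Finset.mem_inter.1 hp).1).pos)
  have hsum : ∑ n ∈ Finset.range (∏ p ∈ s, p ^ 2), ∏ p ∈ s, f p n =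
      ∏ p ∈ s, ∑ n ∈ Finset.range (p ^ 2), f p n := by
    refine sum_range_prod_of_periodic (fun p hp ↦ pow_ne_zero 2 (hsp p hp).ne_zero) ?_ hper
    intro p hp q hq hpq
    exact Nat.Coprime.pow 2 2 ((Nat.coprime_primes (hsp p hp) (hsp q hq)).2 hpq)
  set μ : ℝ := if d = e then ∏ p ∈ d.primeFactors, sieveDensity p else 0 with hμ
  have hμ0 : 0 ≤ μ := by
    rw [hμ]
    split_ifs
    · refine Finset.prod_nonneg fun p hp ↦ le_trans (by positivity)
        (two_div_le_sieveDensity (Nat.prime_of_mem_primeFactors hp).two_le)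
    · exact le_rfl
  have hmean : ∏ p ∈ s, ∑ n ∈ Finset.range (p ^ 2), f p n = ((∏ p ∈ s, p ^ 2 : ℕ) : ℝ) * μ := by
    by_cases hde : d = e
    · subst hde
      rw [hμ, if_pos rfl]
      have : s = d.primeFactors := Finset.union_self _
      rw [this]
      push_cast
      rw [← Finset.prod_mul_distrib]
      refine Finset.prod_congr rfl fun p hp ↦ ?_
      rw [← sum_range_sieveWeight_sq (Nat.prime_of_mem_primeFactors hp) (hdp p hp).1 (hdp p hp).2]
      simp only [hf, if_pos hp, sq]
    · rw [hμ, if_neg hde, mul_zero]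
      have hne : d.primeFactors ≠ e.primeFactors := fun h ↦ hde (by
        rw [← Nat.prod_primeFactors_of_squarefree hd, h, Nat.prod_primeFactors_of_squarefree he])
      obtain ⟨p, hp⟩ : ∃ p, ¬ (p ∈ d.primeFactors ↔ p ∈ e.primeFactors) := by
        by_contra! h
        exact hne (Finset.ext h)
      have hps : p ∈ s := by
        rw [hs, Finset.mem_union]
        tauto
      refine Finset.prod_eq_zero hps ?_
      rw [← sum_range_sieveWeight (hsp p hps) (hskh p hps).1 (hskh p hps).2]
      refine Finset.sum_congr rfl fun n _ ↦ ?_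
      simp only [hf]
      by_cases h1 : p ∈ d.primeFactors
      · have h2 : p ∉ e.primeFactors := by tauto
        rw [if_pos h1, if_neg h2, mul_one]
      · have h2 : p ∈ e.primeFactors := by tauto
        rw [if_neg h1, if_pos h2, one_mul]
  simp only [hprod]
  have key := sum_range_le_of_periodic hM (periodic_prod hper) (fun n ↦ ?_) hμ0 (hsum.trans hmean) N
  · refine key.trans ?_
    rw [hμ, mul_ite, mul_zero]
    gcongr
    exact_mod_cast hMle
  · refine (le_abs_self _).trans ?_
    rw [Finset.abs_prod]
    exact Finset.prod_le_one (fun _ _ ↦ abs_nonneg _) fun p hp ↦ habs p hp n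

theorem sieveWeight_eq_sieveDensity {k h : ℤ} {p n : ℕ} (hp : p.Prime) (hp3 : p % 4 = 3)
    (hn : (n : ℤ) ∈ sumTwoSquaresSet) (hkn : k * n + h ∈ sumTwoSquaresSet) :
    sieveWeight k h p n = sieveDensity p := by
  rw [sieveWeight, if_neg]
  rintro (h | h)
  exacts [not_exactlyDvd_of_mem hp hp3 hn h, not_exactlyDvd_of_mem hp hp3 hkn h]

theorem card_mul_sq_le {k h : ℤ} (D N : ℕ) (S : Finset ℕ) (hSN : S ⊆ Finset.range N)
    (hS : ∀ n ∈ S, (n : ℤ) ∈ sumTwoSquaresSet ∧ k * n + h ∈ sumTwoSquaresSet) {G : ℝ}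
    (hG : G = ∑ d ∈ sieveModuli (h * k).natAbs D, ∏ p ∈ d.primeFactors, sieveDensity p) :
    (S.card : ℝ) * G ^ 2 ≤ N * G + (D : ℝ) ^ 6 := by
  set 𝒟 := sieveModuli (h * k).natAbs D
  have h𝒟 : ∀ d ∈ 𝒟, d ≤ D ∧ Squarefree d ∧
      ∀ p ∈ d.primeFactors, p % 4 = 3 ∧ ¬ (p : ℤ) ∣ k ∧ ¬ (p : ℤ) ∣ h := by
    intro d hd
    obtain ⟨h1, h2, h3⟩ := Finset.mem_filter.1 hd
    obtain ⟨-, h4, h5⟩ := mem_primesModFour.1 h1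
    refine ⟨h4, h2, fun p hp ↦ ?_⟩
    have hpp := Nat.prime_of_mem_primeFactors hp
    have hpd := Nat.dvd_of_mem_primeFactors hp
    have h6 : ¬ (p : ℤ) ∣ h * k := fun h7 ↦
      Nat.not_coprime_of_dvd_of_dvd hpp.one_lt hpd (Int.natCast_dvd.1 h7) h3
    exact ⟨h5 p hpp hpd, fun h7 ↦ h6 (h7.mul_left _), fun h7 ↦ h6 (h7.mul_right _)⟩
  have h𝒟card : (𝒟.card : ℝ) ≤ D := by
    have : 𝒟 ⊆ Finset.Icc 1 D := (Finset.filter_subset _ _).trans (Finset.filter_subset _ _)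
    have := Finset.card_le_card this
    rw [Nat.card_Icc, Nat.add_sub_cancel] at this
    exact_mod_cast this
  set W : ℕ → ℕ → ℝ := fun d n ↦ ∏ p ∈ d.primeFactors, sieveWeight k h p n
  have hWS : ∀ n ∈ S, ∑ d ∈ 𝒟, W d n = G := by
    intro n hn
    rw [hG]
    refine Finset.sum_congr rfl fun d hd ↦ Finset.prod_congr rfl fun p hp ↦ ?_
    exact sieveWeight_eq_sieveDensity (Nat.prime_of_mem_primeFactors hp) ((h𝒟 d hd).2.2 p hp).1
      (hS n hn).1 (hS n hn).2
  calc (S.card : ℝ) * G ^ 2 = ∑ n ∈ S, (∑ d ∈ 𝒟, W d n) ^ 2 := by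
        rw [← nsmul_eq_mul, ← Finset.sum_const]
        exact Finset.sum_congr rfl fun n hn ↦ by rw [hWS n hn]
    _ ≤ ∑ n ∈ Finset.range N, (∑ d ∈ 𝒟, W d n) ^ 2 :=
        Finset.sum_le_sum_of_subset_of_nonneg hSN fun _ _ _ ↦ sq_nonneg _
    _ = ∑ d ∈ 𝒟, ∑ e ∈ 𝒟, ∑ n ∈ Finset.range N, W d n * W e n := by
        simp only [sq, Finset.sum_mul_sum]
        rw [Finset.sum_comm]
        exact Finset.sum_congr rfl fun d _ ↦ Finset.sum_comm
    _ ≤ ∑ d ∈ 𝒟, ∑ e ∈ 𝒟, ((if d = e then N * ∏ p ∈ d.primeFactors, sieveDensity p else 0) +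
          (D : ℝ) ^ 4) := by
        refine Finset.sum_le_sum fun d hd ↦ Finset.sum_le_sum fun e he ↦ ?_
        obtain ⟨hd1, hd2, hd3⟩ := h𝒟 d hd
        obtain ⟨he1, he2, he3⟩ := h𝒟 e he
        refine (sum_range_prod_mul_prod_sieveWeight_le hd2 he2 (fun p hp ↦ (hd3 p hp).2)
          (fun p hp ↦ (he3 p hp).2) N).trans ?_
        gcongr
        calc ((d * e : ℕ) : ℝ) ^ 2 ≤ ((D * D : ℕ) : ℝ) ^ 2 := by gcongr
          _ = (D : ℝ) ^ 4 := by push_cast; ring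
    _ = N * G + 𝒟.card ^ 2 * (D : ℝ) ^ 4 := by
        simp only [Finset.sum_add_distrib, Finset.sum_ite_eq, Finset.sum_const, nsmul_eq_mul]
        rw [hG, Finset.mul_sum]
        congr 1
        · exact Finset.sum_congr rfl fun d hd ↦ if_pos hd
        · ring
    _ ≤ N * G + (D : ℝ) ^ 2 * (D : ℝ) ^ 4 := by gcongr
    _ = _ := by ring

theorem one_le_sum_prod_sieveDensity (m : ℕ) {D : ℕ} (hD : 1 ≤ D) :
    1 ≤ ∑ d ∈ sieveModuli m D, ∏ p ∈ d.primeFactors, sieveDensity p := by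
  have h1 : 1 ∈ sieveModuli m D := by
    simp [sieveModuli, one_mem_primesModFour 3 hD]
  calc (1 : ℝ) = ∏ p ∈ Nat.primeFactors 1, sieveDensity p := by simp
    _ ≤ _ := Finset.single_le_sum (f := fun d ↦ ∏ p ∈ d.primeFactors, sieveDensity p)
      (fun d _ ↦ Finset.prod_nonneg fun p hp ↦ le_trans (by positivity)
        (two_div_le_sieveDensity (Nat.prime_of_mem_primeFactors hp).two_le)) h1

theorem log_le_mul_sum_prod_sieveDensity {m N : ℕ} (hm : m ≠ 0) (hN : 1 ≤ N) :
    Real.log (N + 1) ≤ 128 * ((m : ℝ) / m.totient) ^ 2 *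
      ∑ d ∈ sieveModuli m (N * N), ∏ p ∈ d.primeFactors, sieveDensity p := by
  calc Real.log (N + 1) ≤ _ := log_le_mul_sum_squarefree hN
    _ ≤ 128 * (((m : ℝ) / m.totient) ^ 2 *
        ∑ n ∈ sieveModuli m (N * N), ∏ p ∈ n.primeFactors, (2 / p : ℝ)) := by
        gcongr
        exact sum_squarefree_le_mul_sum_sieveModuli m (N * N) hm
    _ ≤ _ := by
        rw [mul_assoc]
        gcongr
        exact two_div_le_sieveDensity (Nat.prime_of_mem_primeFactors ‹_›).two_le

theorem card_le_of_two_squares {k h : ℤ} (hk : k ≠ 0) (hh : h ≠ 0) {x : ℝ} (hx : 2 ≤ x)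
    (S : Finset ℕ) (hSx : ∀ n ∈ S, (n : ℝ) ≤ x)
    (hS : ∀ n ∈ S, (n : ℤ) ∈ sumTwoSquaresSet ∧ k * n + h ∈ sumTwoSquaresSet) :
    (S.card : ℝ) ≤
      6146 * (((h * k).natAbs : ℝ) / (Nat.totient (h * k).natAbs : ℝ)) ^ 2 * x / Real.log x := by
  set m := (h * k).natAbs
  have hm : m ≠ 0 := Int.natAbs_ne_zero.2 (mul_ne_zero hh hk)
  set A : ℝ := ((m : ℝ) / m.totient) ^ 2
  have hA : 1 ≤ A := by
    have h1 : (0 : ℝ) < m.totient := by exact_mod_cast Nat.totient_pos.2 (Nat.pos_of_ne_zero hm)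
    have h2 : (m.totient : ℝ) ≤ m := by exact_mod_cast Nat.totient_le m
    exact one_le_pow₀ ((one_le_div h1).2 h2)
  have hx0 : 0 < x := by linarith
  set y := ⌊x ^ (1 / 24 : ℝ)⌋₊
  have hy1 : 1 ≤ y := Nat.one_le_floor_iff _ |>.2 (Real.one_le_rpow (by linarith) (by norm_num))
  have hlog : Real.log x ≤ 24 * Real.log (y + 1) := by
    have h1 : x ^ (1 / 24 : ℝ) ≤ y + 1 := (Nat.lt_floor_add_one _).le
    have h2 := Real.log_le_log (by positivity) h1
    rw [Real.log_rpow hx0] at h2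
    linarith
  have hD : ((y * y : ℕ) : ℝ) ^ 6 ≤ √x := by
    have h1 : (y : ℝ) ≤ x ^ (1 / 24 : ℝ) := Nat.floor_le (by positivity)
    calc ((y * y : ℕ) : ℝ) ^ 6 = (y : ℝ) ^ 12 := by push_cast; ring
      _ ≤ (x ^ (1 / 24 : ℝ)) ^ 12 := by gcongr
      _ = √x := by
        rw [← Real.rpow_natCast, ← Real.rpow_mul hx0.le, Real.sqrt_eq_rpow]
        norm_num
  have hlogpos : 0 < Real.log x := Real.log_pos (by linarith)
  set G := ∑ d ∈ sieveModuli m (y * y), ∏ p ∈ d.primeFactors, sieveDensity p with hG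
  have hG1 : 1 ≤ G := one_le_sum_prod_sieveDensity m (Nat.mul_pos hy1 hy1)
  have hG2 : Real.log x ≤ 3072 * A * G := by
    have := log_le_mul_sum_prod_sieveDensity hm hy1
    linarith
  have hN : ((⌊x⌋₊ + 1 : ℕ) : ℝ) ≤ 2 * x := by
    have := Nat.floor_le hx0.le
    push_cast
    linarith
  have key := card_mul_sq_le (y * y) (⌊x⌋₊ + 1) S
    (fun n hn ↦ Finset.mem_range.2 (Nat.lt_succ_of_le (Nat.le_floor (hSx n hn)))) hS hG
  have h1 : (S.card : ℝ) ≤ 2 * x / G + √x := by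
    have hGpos : 0 < G := by linarith
    have h2 : (S.card : ℝ) * G ^ 2 ≤ (2 * x / G + √x) * G ^ 2 := by
      calc (S.card : ℝ) * G ^ 2 ≤ 2 * x * G + √x * 1 := by
            rw [mul_one]; exact key.trans (by gcongr)
        _ ≤ 2 * x * G + √x * G ^ 2 := by gcongr; exact one_le_pow₀ hG1
        _ = _ := by field_simp
    exact le_of_mul_le_mul_right h2 (by positivity)
  have h3 : 2 * x / G ≤ 6144 * A * x / Real.log x := by
    rw [div_le_div_iff₀ (by linarith) hlogpos]
    calc 2 * x * Real.log x ≤ 2 * x * (3072 * A * G) := by gcongr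
      _ = _ := by ring
  have h4 : √x ≤ 2 * A * x / Real.log x := by
    rw [le_div_iff₀ hlogpos]
    have h5 : Real.log x ≤ 2 * √x := by
      have h6 := Real.log_le_sub_one_of_pos (Real.sqrt_pos.2 hx0)
      rw [Real.log_sqrt hx0.le] at h6
      linarith
    calc √x * Real.log x ≤ √x * (2 * √x) := by gcongr
      _ = 2 * 1 * x := by rw [mul_left_comm, Real.mul_self_sqrt hx0.le, mul_one]
      _ ≤ 2 * A * x := by gcongr
  calc (S.card : ℝ) ≤ 6144 * A * x / Real.log x + 2 * A * x / Real.log x := by linarith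
    _ = _ := by ring

theorem sieve_bound_two_squares_pairs :
    ∃ c : ℝ, 0 < c ∧ ∀ k h : ℤ, 0 < k → h ≠ 0 → ∀ x : ℝ, 2 ≤ x →
      ({n : ℤ | 1 ≤ n ∧ (n : ℝ) ≤ x ∧ n ∈ sumTwoSquaresSet ∧
          k * n + h ∈ sumTwoSquaresSet}.ncard : ℝ) ≤
        c * (((h * k).natAbs : ℝ) / (Nat.totient (h * k).natAbs : ℝ)) ^ 2 *
          x / Real.log x := by
  refine ⟨6146, by norm_num, fun k h hk hh x hx ↦ ?_⟩
  set T : Set ℤ := {n : ℤ | 1 ≤ n ∧ (n : ℝ) ≤ x ∧ n ∈ sumTwoSquaresSet ∧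
    k * n + h ∈ sumTwoSquaresSet} with hT
  have hfin : T.Finite := (Set.finite_Icc 1 ⌊x⌋).subset fun n hn ↦ ⟨hn.1, Int.le_floor.2 hn.2.1⟩
  have hcast : ∀ n ∈ T, ((n.toNat : ℕ) : ℤ) = n := fun n hn ↦
    Int.toNat_of_nonneg (zero_le_one.trans hn.1)
  have hcard : T.ncard = (hfin.toFinset.image Int.toNat).card := by
    rw [Set.ncard_eq_toFinset_card T hfin, Finset.card_image_of_injOn]
    intro a ha b hb hab
    rw [← hcast a (hfin.mem_toFinset.1 ha), ← hcast b (hfin.mem_toFinset.1 hb)]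
    exact congrArg _ hab
  rw [hcard]
  refine card_le_of_two_squares hk.ne' hh hx _ (fun n hn ↦ ?_) fun n hn ↦ ?_
  · obtain ⟨z, hz, rfl⟩ := Finset.mem_image.1 hn
    rw [hfin.mem_toFinset] at hz
    rw [← Int.cast_natCast, hcast z hz]
    exact hz.2.1
  · obtain ⟨z, hz, rfl⟩ := Finset.mem_image.1 hn
    rw [hfin.mem_toFinset] at hz
    rw [hcast z hz]
    exact hz.2.2
end

section
/- Robert–Sargos counting lemma: let k ≥ 2 be a fixed integer. For every ε > 0 there exists a constant C = C(k, ε) > 0 such that for every integer N ≥ 1 and every real δ > 0, the number of quadruples of integers (n₁, n₂, n₃, n₄) with N < n_i ≤ 2N for i = 1,2,3,4 and |n₁^{1/k} + n₂^{1/k} − n₃^{1/k} − n₄^{1/k}| < δ·N^{1/k} is at most C·N^ε·(N⁴δ + N²). -/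
open Real

open MeasureTheory in
theorem integral_cos_two_pi_mul_dotProduct {ι : Type*} [Fintype ι] (m : ι → ℤ) (hm : m ≠ 0) :
    ∫ θ in Set.pi Set.univ fun _ : ι ↦ Set.Ico (0 : ℝ) 1, cos (2 * π * ∑ j, (m j : ℝ) * θ j) = 0 := by
  have key : ∫ θ in Set.pi Set.univ fun _ : ι ↦ Set.Ico (0 : ℝ) 1,
      ∏ j, Complex.exp ((2 * π * Complex.I * m j) * (θ j : ℝ)) = 0 := by
    rw [volume_pi, Measure.restrict_pi_pi,
      integral_fintype_prod_eq_prod (𝕜 := ℂ) (fun j (x : ℝ) ↦ Complex.exp ((2 * π * Complex.I * m j) * x))]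
    obtain ⟨j, hj⟩ := Function.ne_iff.mp hm
    refine Finset.prod_eq_zero (Finset.mem_univ j) ?_
    have hc : (2 * π * Complex.I * m j : ℂ) ≠ 0 := by
      have : (m j : ℂ) ≠ 0 := by exact_mod_cast hj
      simp [Real.pi_ne_zero, this]
    rw [integral_Ico_eq_integral_Ioc, ← intervalIntegral.integral_of_le zero_le_one,
      integral_exp_mul_complex hc]
    have : Complex.exp (2 * π * Complex.I * m j) = 1 := by
      rw [mul_comm]; exact Complex.exp_int_mul_two_pi_mul_I _
    simp [this]
  have hre : ∀ θ : ι → ℝ, cos (2 * π * ∑ j, (m j : ℝ) * θ j) =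
      Complex.reCLM (∏ j, Complex.exp ((2 * π * Complex.I * m j) * (θ j : ℝ))) := by
    intro θ
    rw [← Complex.exp_sum, Complex.reCLM_apply, ← Complex.exp_ofReal_mul_I_re]
    congr 2
    push_cast
    rw [Finset.mul_sum, Finset.sum_mul]
    exact Finset.sum_congr rfl fun j _ ↦ by ring
  simp_rw [hre]
  rw [ContinuousLinearMap.integral_comp_comm, key, map_zero]
  refine Measure.integrableOn_of_bounded (M := 1) ?_ ?_ ?_
  · rw [volume_pi_pi]; simp
  · exact Continuous.aestronglyMeasurable (by fun_prop)
  · refine Filter.Eventually.of_forall fun θ ↦ ?_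
    rw [norm_prod]
    refine (Finset.prod_eq_one fun j _ ↦ ?_).le
    rw [Complex.norm_exp]
    simp

open MeasureTheory in
theorem lintegral_normSq_expSum {ι : Type*} [Fintype ι] (F : Finset (ι → ℤ)) :
    ∫⁻ θ in Set.pi Set.univ fun _ : ι ↦ Set.Ico (0 : ℝ) 1,
      ENNReal.ofReal ((∑ n ∈ F, cos (2 * π * ∑ j, (n j : ℝ) * θ j)) ^ 2 +
        (∑ n ∈ F, sin (2 * π * ∑ j, (n j : ℝ) * θ j)) ^ 2) = F.card := by
  classical
  have hfin : volume (Set.pi Set.univ fun _ : ι ↦ Set.Ico (0 : ℝ) 1) ≠ ⊤ := by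
    rw [volume_pi_pi]; simp
  have hcos : ∀ m : ι → ℤ, IntegrableOn (fun θ : ι → ℝ ↦ cos (2 * π * ∑ j, (m j : ℝ) * θ j))
      (Set.pi Set.univ fun _ : ι ↦ Set.Ico (0 : ℝ) 1) := by
    intro m
    refine Measure.integrableOn_of_bounded (M := 1) hfin
      (Continuous.aestronglyMeasurable (by fun_prop)) ?_
    exact Filter.Eventually.of_forall fun θ ↦ by simpa using abs_cos_le_one _
  have hexp : ∀ θ : ι → ℝ, (∑ n ∈ F, cos (2 * π * ∑ j, (n j : ℝ) * θ j)) ^ 2 +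
        (∑ n ∈ F, sin (2 * π * ∑ j, (n j : ℝ) * θ j)) ^ 2 =
      ∑ n ∈ F, ∑ n' ∈ F, cos (2 * π * ∑ j, ((n - n') j : ℤ) * θ j) := by
    intro θ
    rw [sq, sq, Finset.sum_mul_sum, Finset.sum_mul_sum, ← Finset.sum_add_distrib]
    refine Finset.sum_congr rfl fun n _ ↦ ?_
    rw [← Finset.sum_add_distrib]
    refine Finset.sum_congr rfl fun n' _ ↦ ?_
    rw [← cos_sub, ← mul_sub, ← Finset.sum_sub_distrib]
    congr 2
    refine Finset.sum_congr rfl fun j _ ↦ ?_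
    rw [Pi.sub_apply]
    push_cast
    ring
  rw [← ofReal_integral_eq_lintegral_ofReal]
  · simp_rw [hexp]
    rw [integral_finsetSum _ fun n _ ↦ integrable_finsetSum _ fun n' _ ↦ hcos _]
    have : ∀ n ∈ F, ∫ θ in Set.pi Set.univ fun _ : ι ↦ Set.Ico (0 : ℝ) 1,
        ∑ n' ∈ F, cos (2 * π * ∑ j, ((n - n') j : ℤ) * θ j) = 1 := by
      intro n hn
      rw [integral_finsetSum _ fun n' _ ↦ hcos _, Finset.sum_eq_single n]
      · simp [Measure.real, volume_pi_pi]
      · intro n' _ hne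
        exact integral_cos_two_pi_mul_dotProduct _ (sub_ne_zero.mpr hne.symm)
      · exact fun h ↦ (h hn).elim
    rw [Finset.sum_congr rfl this]
    simp
  · simp_rw [hexp]
    exact integrable_finsetSum _ fun n _ ↦ integrable_finsetSum _ fun n' _ ↦ hcos _
  · exact Filter.Eventually.of_forall fun θ ↦ by positivity

open MeasureTheory in
theorem setLIntegral_le_card_mul_of_periodic {ι : Type*} [Fintype ι] (D : Set (ι → ℝ))
    (hD : MeasurableSet D) (G : Finset (ι → ℤ))
    (hG : ∀ x ∈ D, ∀ y ∈ D, ∀ m : ι → ℤ, (∀ j, (m j : ℝ) = x j - y j) → m ∈ G)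
    (h : (ι → ℝ) → ENNReal) (hm : Measurable h)
    (hper : ∀ (m : ι → ℤ) θ, h (fun j ↦ m j + θ j) = h θ) :
    ∫⁻ θ in D, h θ ≤
      G.card * ∫⁻ θ in Set.pi Set.univ fun _ : ι ↦ Set.Ico (0 : ℝ) 1, h θ := by
  classical
  have hfd := ZSpan.isAddFundamentalDomain' (Pi.basisFun ℝ ι) volume
  rw [ZSpan.fundamentalDomain_pi_basisFun] at hfd
  have hint : ∀ g : (Submodule.span ℤ (Set.range (Pi.basisFun ℝ ι))).toAddSubgroup,
      ∃ m : ι → ℤ, ∀ j, (m j : ℝ) = (g : ι → ℝ) j := by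
    intro g
    have := ((Pi.basisFun ℝ ι).mem_span_iff_repr_mem ℤ (g : ι → ℝ)).mp g.2
    choose m hm using this
    exact ⟨m, fun j ↦ by simpa using hm j⟩
  choose z hz using hint
  have hzinj : Function.Injective z := by
    intro g g' hgg
    ext j
    rw [← hz, ← hz, hgg]
  have := hzinj.countable
  have hshift : ∀ (g : (Submodule.span ℤ (Set.range (Pi.basisFun ℝ ι))).toAddSubgroup) (θ : ι → ℝ),
      h (g +ᵥ θ) = h θ := by
    intro g θ
    rw [← hper (z g) θ]
    congr 1
    ext j
    rw [hz]; rfl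
  rw [← lintegral_indicator hD, hfd.lintegral_eq_tsum'', ← lintegral_tsum,
    ← lintegral_const_mul _ hm]
  · refine lintegral_mono fun θ ↦ ?_
    refine ENNReal.summable.tsum_le_of_sum_le fun s ↦ ?_
    have h1 : ∀ g ∈ s, D.indicator h (g +ᵥ θ) = if g +ᵥ θ ∈ D then h θ else 0 := by
      intro g _
      rw [Set.indicator_apply, hshift]
    rw [Finset.sum_congr rfl h1, ← Finset.sum_filter, Finset.sum_const, nsmul_eq_mul]
    gcongr
    rcases (s.filter fun g ↦ g +ᵥ θ ∈ D).eq_empty_or_nonempty with he | ⟨g0, hg0⟩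
    · simp [he]
    refine Finset.card_le_card_of_injOn (fun g ↦ z g - z g0) ?_ ?_
    · intro g hg
      have hg' := (Finset.mem_filter.mp hg).2
      refine hG _ hg' _ (Finset.mem_filter.mp hg0).2 _ fun j ↦ ?_
      simp only [Pi.sub_apply, Int.cast_sub, hz]
      change _ = ((g : ι → ℝ) j + θ j) - ((g0 : ι → ℝ) j + θ j)
      ring
    · intro g _ g' _ hgg
      exact hzinj (by simpa using hgg)
  · intro g
    exact ((hm.indicator hD).comp (measurable_const_vadd g)).aemeasurable

open MeasureTheory in
/-- The number of integer points in the parallelepiped `|A n| ≤ 1`, multiplied by its inverse volume,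
is bounded by the number of integer points in the dual parallelepiped. -/
theorem card_mul_det_le_card_dual {ι : Type*} [Fintype ι] [DecidableEq ι] [Nonempty ι]
    (A : Matrix ι ι ℝ)
    (F G : Finset (ι → ℤ)) (hF : ∀ n ∈ F, ∀ i, |∑ j, A i j * n j| ≤ 1)
    (hG : ∀ t : ι → ℝ, (∀ i, |t i| ≤ 1) →
      ∀ m : ι → ℤ, (∀ j, (m j : ℝ) = ∑ i, t i * A i j) → m ∈ G) :
    F.card * |A.det| ≤ 4 * (4 * Fintype.card ι) ^ Fintype.card ι * G.card := by
  set d := Fintype.card ι with hd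
  have hd0 : (1 : ℝ) ≤ d := by exact_mod_cast Fintype.card_pos
  set κ : ℝ := 1 / (8 * d) with hκ
  have hκ0 : 0 < κ := by positivity
  set B : Set (ι → ℝ) := Set.pi Set.univ fun _ ↦ Set.Icc (-κ) κ with hB
  set D : Set (ι → ℝ) := Matrix.toLin' A.transpose '' B with hD
  have hDc : IsCompact D :=
    (isCompact_univ_pi fun _ ↦ isCompact_Icc).image
      (LinearMap.continuous_of_finiteDimensional _)
  have happ : ∀ t : ι → ℝ, ∀ j, Matrix.toLin' A.transpose t j = ∑ i, t i * A i j := by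
    intro t j
    simp [Matrix.mulVec, dotProduct, mul_comm]
  set h : (ι → ℝ) → ENNReal := fun θ ↦
    ENNReal.ofReal ((∑ n ∈ F, cos (2 * π * ∑ j, (n j : ℝ) * θ j)) ^ 2 +
        (∑ n ∈ F, sin (2 * π * ∑ j, (n j : ℝ) * θ j)) ^ 2) with hh
  have hvol : volume D = ENNReal.ofReal (|A.det| * (2 * κ) ^ d) := by
    rw [hD, Measure.addHaar_image_linearMap, LinearMap.det_toLin', Matrix.det_transpose, hB,
      volume_pi_pi]
    rw [ENNReal.ofReal_mul (abs_nonneg _)]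
    congr 1
    rw [Finset.prod_const, Real.volume_Icc, ← ENNReal.ofReal_pow (by linarith)]
    rw [Finset.card_univ]
    congr 2; ring
  have hmeas : Measurable h :=
    ENNReal.measurable_ofReal.comp (Continuous.measurable (by fun_prop))
  have hup := setLIntegral_le_card_mul_of_periodic D hDc.measurableSet G ?_ h
    hmeas ?_
  · have hlow : ∫⁻ _ in D, ENNReal.ofReal ((F.card : ℝ) ^ 2 / 4) ≤ ∫⁻ θ in D, h θ := by
      refine setLIntegral_mono hmeas fun θ hθ ↦ ?_
      refine ENNReal.ofReal_le_ofReal ?_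
      obtain ⟨t, ht, rfl⟩ := hθ
      have hc : ∀ n ∈ F, (1 / 2 : ℝ) ≤
          cos (2 * π * ∑ j, (n j : ℝ) * Matrix.toLin' A.transpose t j) := by
        intro n hn
        have h1 : ∑ j, (n j : ℝ) * Matrix.toLin' A.transpose t j =
            ∑ i, t i * ∑ j, A i j * n j := by
          simp_rw [happ, Finset.mul_sum]
          rw [Finset.sum_comm]
          exact Finset.sum_congr rfl fun _ _ ↦ Finset.sum_congr rfl fun _ _ ↦ by ring
        have h2 : |∑ i, t i * ∑ j, A i j * n j| ≤ 1 / 8 := by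
          calc _ ≤ ∑ i, |t i * ∑ j, A i j * n j| := Finset.abs_sum_le_sum_abs _ _
            _ ≤ ∑ _i : ι, κ := by
              refine Finset.sum_le_sum fun i _ ↦ ?_
              rw [abs_mul, ← mul_one κ]
              have : |t i| ≤ κ := abs_le.mpr (ht i (Set.mem_univ i))
              exact mul_le_mul this (hF n hn i) (abs_nonneg _) hκ0.le
            _ = 1 / 8 := by
              rw [Finset.sum_const, Finset.card_univ, nsmul_eq_mul, hκ, ← hd]
              field_simp
        rw [h1]
        refine le_trans ?_ one_sub_sq_div_two_le_cos
        have h3 : (∑ i, t i * ∑ j, A i j * n j) ^ 2 ≤ (1 / 8) ^ 2 := by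
          rw [← sq_abs]; gcongr
        have h4 : π ^ 2 ≤ 4 ^ 2 := by
          have := pi_le_four; have := pi_pos; gcongr
        rw [mul_pow, mul_pow]
        nlinarith [mul_le_mul h4 h3 (by positivity) (by positivity)]
      have hs : (F.card : ℝ) / 2 ≤
          ∑ n ∈ F, cos (2 * π * ∑ j, (n j : ℝ) * Matrix.toLin' A.transpose t j) := by
        have := Finset.card_nsmul_le_sum F _ _ hc
        rw [nsmul_eq_mul] at this
        linarith
      have h0 : (0 : ℝ) ≤ F.card / 2 := by positivity
      nlinarith [pow_le_pow_left₀ h0 hs 2,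
        sq_nonneg (∑ n ∈ F, sin (2 * π * ∑ j, (n j : ℝ) * Matrix.toLin' A.transpose t j))]
    have := hlow.trans hup
    rw [lintegral_normSq_expSum, setLIntegral_const, hvol,
      ← ENNReal.ofReal_mul (by positivity)] at this
    have h5 : (F.card : ℝ) ^ 2 / 4 * (|A.det| * (2 * κ) ^ d) ≤ G.card * F.card := by
      rw [← Nat.cast_mul, ← ENNReal.ofReal_natCast] at this
      have := (ENNReal.ofReal_le_ofReal_iff (by positivity)).mp this
      exact_mod_cast this
    rcases Nat.eq_zero_or_pos F.card with h0 | h0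
    · rw [h0]; simp; positivity
    have h0' : (0 : ℝ) < F.card := by exact_mod_cast h0
    have h6 : (F.card : ℝ) * |A.det| * (2 * κ) ^ d ≤ 4 * G.card := by
      refine le_of_mul_le_mul_right ?_ h0'
      nlinarith
    have h7 : (2 * κ) ^ d * (4 * (d : ℝ)) ^ d = 1 := by
      rw [← mul_pow, hκ]
      have : 2 * (1 / (8 * (d : ℝ))) * (4 * d) = 1 := by field_simp; norm_num
      rw [this, one_pow]
    calc (F.card : ℝ) * |A.det| = F.card * |A.det| * (2 * κ) ^ d * (4 * d) ^ d := by
          rw [mul_assoc _ ((2 * κ) ^ d), h7, mul_one]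
      _ ≤ 4 * G.card * (4 * d) ^ d := by gcongr
      _ = _ := by ring
  · rintro _ ⟨x, hx, rfl⟩ _ ⟨y, hy, rfl⟩ m hm
    refine hG (x - y) (fun i ↦ ?_) m fun j ↦ ?_
    · have h1 := hx i (Set.mem_univ i)
      have h2 := hy i (Set.mem_univ i)
      have : κ ≤ 1 / 2 := by
        rw [hκ]; gcongr; linarith
      rw [Pi.sub_apply, abs_le]
      constructor <;> linarith [h1.1, h1.2, h2.1, h2.2]
    · rw [hm, happ, happ, ← Finset.sum_sub_distrib]
      exact Finset.sum_congr rfl fun i _ ↦ by rw [Pi.sub_apply]; ring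
  · intro m θ
    have : ∀ n : ι → ℤ, 2 * π * ∑ j, (n j : ℝ) * (m j + θ j) =
        2 * π * ∑ j, (n j : ℝ) * θ j + ((∑ j, n j * m j : ℤ) : ℝ) * (2 * π) := by
      intro n
      simp_rw [mul_add, Finset.sum_add_distrib]
      push_cast
      ring
    simp only [hh, this, cos_add_int_mul_two_pi, sin_add_int_mul_two_pi]

theorem rpow_mem_Icc_of_mem_Icc {L x : ℝ} (hL : 1 ≤ L) (hx : x ∈ Set.Icc L⁻¹ L) (s : ℝ) :
    x ^ s ∈ Set.Icc (L ^ |s|)⁻¹ (L ^ |s|) := by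
  have hL0 : 0 < L := by linarith
  have hx0 : 0 < x := lt_of_lt_of_le (by positivity) hx.1
  have hlog : |log x| ≤ log L := by
    rw [abs_le, ← log_inv]
    exact ⟨log_le_log (by positivity) hx.1, log_le_log hx0 hx.2⟩
  have h : |log x * s| ≤ log L * |s| := by
    rw [abs_mul]
    gcongr
  rw [rpow_def_of_pos hx0, rpow_def_of_pos hL0, ← exp_neg, Set.mem_Icc, exp_le_exp, exp_le_exp]
  exact abs_le.mp h

theorem abs_rpow_sub_rpow_le {L x y : ℝ} (hL : 1 ≤ L) (hx : x ∈ Set.Icc L⁻¹ L)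
    (hy : y ∈ Set.Icc L⁻¹ L) (s : ℝ) :
    |x ^ s - y ^ s| ≤ |s| * L ^ |s - 1| * |x - y| := by
  have hL0 : 0 < L := by linarith
  refine Convex.norm_image_sub_le_of_norm_hasDerivWithin_le (f := fun z : ℝ ↦ z ^ s)
    (f' := fun z ↦ s * z ^ (s - 1)) (s := Set.Icc L⁻¹ L) ?_ ?_ (convex_Icc _ _) hy hx
  · intro z hz
    have hz0 : 0 < z := lt_of_lt_of_le (by positivity) hz.1
    exact (hasDerivAt_rpow_const (Or.inl hz0.ne')).hasDerivWithinAt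
  · intro z hz
    have hz0 : 0 < z := lt_of_lt_of_le (by positivity) hz.1
    rw [norm_eq_abs, abs_mul, abs_of_pos (rpow_pos_of_pos hz0 _)]
    gcongr
    exact (rpow_mem_Icc_of_mem_Icc hL hz _).2

theorem abs_rpow_sub_taylor_le {L x y : ℝ} (hL : 1 ≤ L) (hx : x ∈ Set.Icc L⁻¹ L)
    (hy : y ∈ Set.Icc L⁻¹ L) (s : ℝ) :
    |x ^ s - y ^ s - s * y ^ (s - 1) * (x - y)| ≤
      |s| * (|s - 1| * L ^ |s - 1 - 1|) * (x - y) ^ 2 := by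
  have hL0 : 0 < L := by linarith
  have hsub : Set.uIcc y x ⊆ Set.Icc L⁻¹ L := Set.uIcc_subset_Icc hy hx
  have := Convex.norm_image_sub_le_of_norm_hasDerivWithin_le
    (f := fun z : ℝ ↦ z ^ s - s * y ^ (s - 1) * z)
    (f' := fun z ↦ s * z ^ (s - 1) - s * y ^ (s - 1) * 1) (s := Set.uIcc y x)
    (C := |s| * (|s - 1| * L ^ |s - 1 - 1|) * |x - y|) ?_ ?_
    (convex_uIcc _ _) Set.left_mem_uIcc Set.right_mem_uIcc
  · rw [norm_eq_abs, norm_eq_abs] at this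
    rw [← sq_abs (x - y), sq, ← mul_assoc]
    convert this using 2
    ring
  · intro z hz
    have hz0 : 0 < z := lt_of_lt_of_le (by positivity) (hsub hz).1
    exact ((hasDerivAt_rpow_const (Or.inl hz0.ne')).sub
      ((hasDerivAt_id z).const_mul _)).hasDerivWithinAt
  · intro z hz
    rw [norm_eq_abs, mul_one, ← mul_sub, abs_mul, mul_assoc]
    refine mul_le_mul_of_nonneg_left ?_ (abs_nonneg s)
    exact (abs_rpow_sub_rpow_le hL (hsub hz) hy _).trans
      (mul_le_mul_of_nonneg_left (Set.abs_sub_left_of_mem_uIcc hz) (by positivity))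

theorem exists_rpow_bounds (s : ℝ) {L : ℝ} (hL : 1 ≤ L) :
    ∃ A : ℝ, 1 ≤ A ∧ ∀ x ∈ Set.Icc L⁻¹ L, x ^ s ∈ Set.Icc A⁻¹ A ∧
      ∀ y ∈ Set.Icc L⁻¹ L, |x ^ s - y ^ s| ≤ A * |x - y| ∧
        |x ^ s - y ^ s - s * y ^ (s - 1) * (x - y)| ≤ A * (x - y) ^ 2 := by
  have hL0 : 0 < L := by linarith
  have h1 : 1 ≤ L ^ |s| := one_le_rpow hL (abs_nonneg s)
  have h2 : 0 ≤ |s| * L ^ |s - 1| := by positivity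
  have h3 : 0 ≤ |s| * (|s - 1| * L ^ |s - 1 - 1|) := by positivity
  refine ⟨L ^ |s| + |s| * L ^ |s - 1| + |s| * (|s - 1| * L ^ |s - 1 - 1|), by linarith,
    fun x hx ↦ ⟨⟨?_, ?_⟩, fun y hy ↦ ⟨?_, ?_⟩⟩⟩
  · refine le_trans ?_ (rpow_mem_Icc_of_mem_Icc hL hx s).1
    gcongr
    linarith
  · linarith [(rpow_mem_Icc_of_mem_Icc hL hx s).2]
  · refine (abs_rpow_sub_rpow_le hL hx hy s).trans ?_
    gcongr
    linarith
  · refine (abs_rpow_sub_taylor_le hL hx hy s).trans ?_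
    gcongr
    linarith

/-- Nearby points on the surface `x₀ ^ α + x₁ ^ α = x₂ ^ α + 1` almost lie on the tangent
planes of one another. -/
theorem exists_tangent_form_bound {α K C : ℝ} (hα : α ≠ 0) (hK : 1 ≤ K) (hC : 0 ≤ C) :
    ∃ A : ℝ, 1 ≤ A ∧ ∀ ρ x₀ x₁ x₂ y₀ y₁ y₂ : ℝ, 0 ≤ ρ → ρ ≤ 1 →
      x₀ ∈ Set.Icc K⁻¹ K → x₁ ∈ Set.Icc K⁻¹ K → x₂ ∈ Set.Icc K⁻¹ K →
      y₀ ∈ Set.Icc K⁻¹ K → y₁ ∈ Set.Icc K⁻¹ K → y₂ ∈ Set.Icc K⁻¹ K →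
      |x₀ ^ α + x₁ ^ α - x₂ ^ α - 1| ≤ C * ρ ^ 2 →
      |y₀ ^ α + y₁ ^ α - y₂ ^ α - 1| ≤ C * ρ ^ 2 →
      |x₀ - y₀| ≤ ρ → |x₁ - y₁| ≤ ρ →
      |y₀ ^ (α - 1) * x₀ + y₁ ^ (α - 1) * x₁ - y₂ ^ (α - 1) * x₂ - 1| ≤ A * ρ ^ 2 := by
  obtain ⟨A, hA, hA'⟩ := exists_rpow_bounds α hK
  obtain ⟨B, hB, hB'⟩ := exists_rpow_bounds α⁻¹ hA
  set E := B * (2 * A + 2 * C) with hE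
  have hE0 : 0 ≤ E := by positivity
  refine ⟨1 + |α|⁻¹ * (2 * C + 2 * A + A * E ^ 2) + C, ?_, ?_⟩
  · have : 0 ≤ |α|⁻¹ * (2 * C + 2 * A + A * E ^ 2) := by positivity
    linarith
  intro ρ x₀ x₁ x₂ y₀ y₁ y₂ hρ hρ1 hx₀ hx₁ hx₂ hy₀ hy₁ hy₂ hx hy h₀ h₁
  have hpos : ∀ z ∈ Set.Icc K⁻¹ K, 0 < z := fun z hz ↦ lt_of_lt_of_le (by positivity) hz.1
  have hρ2 : ρ ^ 2 ≤ ρ := by nlinarith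
  obtain ⟨l₀, t₀⟩ := (hA' x₀ hx₀).2 y₀ hy₀
  obtain ⟨l₁, t₁⟩ := (hA' x₁ hx₁).2 y₁ hy₁
  obtain ⟨-, t₂⟩ := (hA' x₂ hx₂).2 y₂ hy₂
  have l₀' : |x₀ ^ α - y₀ ^ α| ≤ A * ρ := l₀.trans (by gcongr)
  have l₁' : |x₁ ^ α - y₁ ^ α| ≤ A * ρ := l₁.trans (by gcongr)
  have hCρ : C * ρ ^ 2 ≤ C * ρ := by gcongr
  have l₂ : |x₂ ^ α - y₂ ^ α| ≤ (2 * A + 2 * C) * ρ := by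
    rw [abs_le] at *
    constructor <;> linarith
  have h₂ : |x₂ - y₂| ≤ E * ρ := by
    have := ((hB' _ (hA' x₂ hx₂).1).2 _ (hA' y₂ hy₂).1).1
    rw [rpow_rpow_inv (hpos _ hx₂).le hα, rpow_rpow_inv (hpos _ hy₂).le hα] at this
    calc _ ≤ B * |x₂ ^ α - y₂ ^ α| := this
      _ ≤ B * ((2 * A + 2 * C) * ρ) := by gcongr
      _ = E * ρ := by rw [hE]; ring
  have s₀ : A * (x₀ - y₀) ^ 2 ≤ A * ρ ^ 2 := by
    rw [← sq_abs]; gcongr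
  have s₁ : A * (x₁ - y₁) ^ 2 ≤ A * ρ ^ 2 := by
    rw [← sq_abs]; gcongr
  have s₂ : A * (x₂ - y₂) ^ 2 ≤ A * E ^ 2 * ρ ^ 2 := by
    rw [← sq_abs, mul_assoc, ← mul_pow]; gcongr
  set T := y₀ ^ (α - 1) * (x₀ - y₀) + y₁ ^ (α - 1) * (x₁ - y₁) - y₂ ^ (α - 1) * (x₂ - y₂) with hT
  have hαT : |α * T| ≤ (2 * C + 2 * A + A * E ^ 2) * ρ ^ 2 := by
    rw [hT]
    rw [abs_le] at *
    constructor <;> linarith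
  have hT' : |T| ≤ |α|⁻¹ * (2 * C + 2 * A + A * E ^ 2) * ρ ^ 2 := by
    rw [abs_mul] at hαT
    rw [mul_assoc, ← div_eq_inv_mul, le_div_iff₀ (abs_pos.mpr hα)]
    linarith
  have hpow : ∀ z ∈ Set.Icc K⁻¹ K, z ^ (α - 1) * z = z ^ α := fun z hz ↦ by
    rw [rpow_sub_one (hpos z hz).ne', div_mul_cancel₀ _ (hpos z hz).ne']
  have heq : y₀ ^ (α - 1) * x₀ + y₁ ^ (α - 1) * x₁ - y₂ ^ (α - 1) * x₂ - 1 =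
      T + (y₀ ^ α + y₁ ^ α - y₂ ^ α - 1) := by
    rw [← hpow y₀ hy₀, ← hpow y₁ hy₁, ← hpow y₂ hy₂, hT]
    ring
  rw [heq]
  refine (abs_add_le _ _).trans ?_
  nlinarith [sq_nonneg ρ]

theorem abs_le_of_taylor {b X₀ X₁ X₃ Y₀ Y₁ Y₂ y₀ y₁ e₀ e₁ e₃ r₀ r₁ r₃ c d : ℝ}
    (h₀ : |X₀ - Y₀ - b * y₀ * e₀| ≤ r₀) (h₁ : |X₁ - Y₁ - b * y₁ * e₁| ≤ r₁)
    (h₃ : |X₃ - 1 - b * e₃| ≤ r₃) (hy : |Y₀ + Y₁ - Y₂ - 1| ≤ c)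
    (he : |b * (y₀ * e₀ + y₁ * e₁ - e₃)| ≤ d) :
    |X₀ + X₁ - Y₂ - X₃| ≤ r₀ + r₁ + r₃ + c + d := by
  rw [abs_le] at *
  constructor <;> linarith

set_option maxHeartbeats 1000000 in
/-- An integer point close to the conormal direction at a point of the surface
`y₀ ^ α + y₁ ^ α = y₂ ^ α + 1` is a near solution for the conjugate exponent `α / (α - 1)`. -/
theorem exists_dual_bounds {α K C : ℝ} (hα1 : α ≠ 1) (hK : 1 ≤ K) (hC : 0 ≤ C) :
    ∃ η : ℝ, 0 < η ∧ η ≤ 1 ∧ ∃ A : ℝ, 1 ≤ A ∧ ∀ σ τ u₀ u₁ w y₀ y₁ y₂ p₀ p₁ p₂ p₃ : ℝ,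
      y₀ ∈ Set.Icc K⁻¹ K → y₁ ∈ Set.Icc K⁻¹ K → y₂ ∈ Set.Icc K⁻¹ K →
      0 < τ → 1 ≤ p₂ → σ ≤ 1 →
      |u₀| ≤ η → |u₁| ≤ η → |w| ≤ η → |u₀| ≤ σ → |u₁| ≤ σ → |w| ≤ σ → |w| ≤ 1 / τ →
      |y₀ ^ α + y₁ ^ α - y₂ ^ α - 1| ≤ C / τ ^ 2 →
      p₀ = τ * y₀ ^ (α - 1) + u₀ → p₁ = τ * y₁ ^ (α - 1) + u₁ → p₂ = τ * y₂ ^ (α - 1) →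
      p₃ = τ + y₀ * u₀ + y₁ * u₁ - w →
      (p₀ ∈ Set.Icc (A⁻¹ * p₂) (A * p₂) ∧ p₁ ∈ Set.Icc (A⁻¹ * p₂) (A * p₂) ∧
        p₃ ∈ Set.Icc (A⁻¹ * p₂) (A * p₂)) ∧ p₂ ≤ A * τ ∧
      |p₀ ^ (α / (α - 1)) + p₁ ^ (α / (α - 1)) - p₂ ^ (α / (α - 1)) - p₃ ^ (α / (α - 1))| ≤
        A * p₂ ^ (α / (α - 1) - 2) ∧
      |y₀ - (p₀ / p₃) ^ (α - 1)⁻¹| ≤ A * (σ / p₂) ∧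
      |y₁ - (p₁ / p₃) ^ (α - 1)⁻¹| ≤ A * (σ / p₂) := by
  have hγ : α - 1 ≠ 0 := sub_ne_zero.mpr hα1
  set γ := α - 1 with hγdef
  set b := α / γ with hb
  obtain ⟨A₁, hA₁, hA₁'⟩ := exists_rpow_bounds γ hK
  have hL : 1 ≤ 2 * A₁ := by linarith
  obtain ⟨A₂, hA₂, hA₂'⟩ := exists_rpow_bounds b hL
  obtain ⟨A₃, hA₃, hA₃'⟩ := exists_rpow_bounds (2 - b) hA₁
  have hLL : 1 ≤ (2 * A₁) ^ 2 := one_le_pow₀ hL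
  obtain ⟨A₄, hA₄, hA₄'⟩ := exists_rpow_bounds γ⁻¹ hLL
  have hA₁0 : 0 < A₁ := by linarith
  set E := C + |b| + A₂ * (2 + (2 * K + 1) ^ 2) with hE
  have hE0 : 0 ≤ E := by positivity
  set D := A₄ * ((2 * A₁) * (A₁ * (2 * K + 1) + 1) * A₁) with hD
  have hD0 : 0 ≤ D := by positivity
  set A := 2 * A₁ ^ 2 + A₁ + E * A₃ + D with hA
  have hEA : 0 ≤ E * A₃ := by positivity
  have hA1 : 2 * A₁ ^ 2 ≤ A := by rw [hA]; linarith
  have hA₁A : A₁ ≤ A := by rw [hA]; linarith [sq_nonneg A₁]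
  have hA1' : 1 ≤ A := hA₁.trans hA₁A
  have hA0 : 0 < A := by linarith
  have hsq : 2 * A₁ ≤ (2 * A₁) ^ 2 := by nlinarith
  have hinv1 : (2 * A₁)⁻¹ ≤ A₁ := by
    rw [inv_le_iff_one_le_mul₀ (by positivity)]; nlinarith
  set η := 1 / (2 * A₁ ^ 2 * (2 * K + 1)) with hη
  have hη0 : 0 < η := by positivity
  have hηA : (2 * K + 1) * (A₁ * η) = (2 * A₁)⁻¹ := by
    rw [hη]; field_simp
  refine ⟨η, hη0, ?_, A, hA1', ?_⟩
  · rw [hη, div_le_one (by positivity)]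
    nlinarith
  intro σ τ u₀ u₁ w y₀ y₁ y₂ p₀ p₁ p₂ p₃ hy₀ hy₁ hy₂ hτ hp₂1 hσ hu₀ hu₁ hw hu₀σ hu₁σ hwσ hwτ hy
    hp₀ hp₁ hp₂ hp₃
  have hpos : ∀ z ∈ Set.Icc K⁻¹ K, 0 < z := fun z hz ↦ lt_of_lt_of_le (by positivity) hz.1
  have hσ0 : 0 ≤ σ := (abs_nonneg _).trans hwσ
  have hq₀ := (hA₁' y₀ hy₀).1
  have hq₁ := (hA₁' y₁ hy₁).1
  have hq₂ := (hA₁' y₂ hy₂).1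
  have hqpos : ∀ z ∈ Set.Icc A₁⁻¹ A₁, 0 < z := fun z hz ↦ lt_of_lt_of_le (by positivity) hz.1
  have hbq : ∀ y ∈ Set.Icc K⁻¹ K, (y ^ γ) ^ b = y ^ α ∧ (y ^ γ) ^ (b - 1) = y := by
    intro y hy
    have h1 : γ * b = α := by rw [hb]; field_simp
    have h2 : γ * (b - 1) = 1 := by rw [mul_sub, h1, hγdef]; ring
    rw [← rpow_mul (hpos y hy).le, ← rpow_mul (hpos y hy).le, h1, h2, rpow_one]
    exact ⟨rfl, rfl⟩
  have hqy : ∀ y ∈ Set.Icc K⁻¹ K, (y ^ γ) ^ γ⁻¹ = y := fun y hy ↦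
    rpow_rpow_inv (hpos y hy).le hγ
  have hbq₀ := hbq y₀ hy₀
  have hbq₁ := hbq y₁ hy₁
  have hbq₂ := hbq y₂ hy₂
  have hqy₀ := hqy y₀ hy₀
  have hqy₁ := hqy y₁ hy₁
  set q₀ := y₀ ^ γ with hq₀def
  set q₁ := y₁ ^ γ with hq₁def
  set q₂ := y₂ ^ γ with hq₂def
  have hτA : 1 ≤ τ * A₁ := by
    have : τ * q₂ ≤ τ * A₁ := by gcongr; exact hq₂.2
    linarith
  have hτinv : 1 / τ ≤ A₁ := by
    rw [div_le_iff₀ hτ]; linarith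
  have hyu : |y₀ * u₀ + y₁ * u₁ - w| ≤ K * |u₀| + K * |u₁| + |w| := by
    calc _ ≤ |y₀ * u₀| + |y₁ * u₁| + |w| :=
          (abs_sub _ _).trans (by gcongr; exact abs_add_le _ _)
      _ ≤ _ := by
        rw [abs_mul, abs_mul, abs_of_pos (hpos y₀ hy₀), abs_of_pos (hpos y₁ hy₁)]
        gcongr
        · exact hy₀.2
        · exact hy₁.2
  set e₀ := u₀ / τ with he₀
  set e₁ := u₁ / τ with he₁
  set e₃ := (y₀ * u₀ + y₁ * u₁ - w) / τ with he₃
  have hsmall : ∀ u B : ℝ, |u| ≤ B → |u / τ| ≤ B * (1 / τ) := by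
    intro u B h
    rw [abs_div, abs_of_pos hτ, div_eq_mul_one_div]
    gcongr
  have hesmall : ∀ u, |u| ≤ (2 * K + 1) * η → |u / τ| ≤ (2 * A₁)⁻¹ := by
    intro u h
    refine (hsmall u _ h).trans ?_
    rw [← hηA]
    calc (2 * K + 1) * η * (1 / τ) ≤ (2 * K + 1) * η * A₁ := by gcongr
      _ = _ := by ring
  have hK3 : η ≤ (2 * K + 1) * η := by nlinarith
  have hη₃ : K * |u₀| + K * |u₁| + |w| ≤ (2 * K + 1) * η := by
    have h1 : K * |u₀| ≤ K * η := by gcongr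
    have h2 : K * |u₁| ≤ K * η := by gcongr
    linarith
  have hσ₃ : K * |u₀| + K * |u₁| + |w| ≤ (2 * K + 1) * σ := by
    have h1 : K * |u₀| ≤ K * σ := by gcongr
    have h2 : K * |u₁| ≤ K * σ := by gcongr
    linarith
  have ne₀ : |e₀| ≤ (2 * A₁)⁻¹ := hesmall _ (hu₀.trans hK3)
  have ne₁ : |e₁| ≤ (2 * A₁)⁻¹ := hesmall _ (hu₁.trans hK3)
  have ne₃ : |e₃| ≤ (2 * A₁)⁻¹ := hesmall _ (hyu.trans hη₃)
  have se₀ : |e₀| ≤ σ * (1 / τ) := hsmall _ _ hu₀σ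
  have se₁ : |e₁| ≤ σ * (1 / τ) := hsmall _ _ hu₁σ
  have se₃ : |e₃| ≤ (2 * K + 1) * σ * (1 / τ) := hsmall _ _ (hyu.trans hσ₃)
  have hinv : A₁⁻¹ = 2 * (2 * A₁)⁻¹ := by field_simp
  have hinvpos : 0 < (2 * A₁)⁻¹ := by positivity
  have hnear : ∀ q ∈ Set.Icc A₁⁻¹ A₁, ∀ e, |e| ≤ (2 * A₁)⁻¹ →
      q + e ∈ Set.Icc (2 * A₁)⁻¹ (2 * A₁) := by
    intro q hq e he
    have := abs_le.mp he
    constructor <;> linarith [hq.1, hq.2]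
  have hone : (1 : ℝ) ∈ Set.Icc A₁⁻¹ A₁ := ⟨inv_le_one_of_one_le₀ hA₁, hA₁⟩
  have hx₀ := hnear q₀ hq₀ e₀ ne₀
  have hx₁ := hnear q₁ hq₁ e₁ ne₁
  have hx₃ := hnear 1 hone e₃ ne₃
  have hz : |(0 : ℝ)| ≤ (2 * A₁)⁻¹ := by rw [abs_zero]; exact hinvpos.le
  have hx₂ := hnear q₂ hq₂ 0 hz
  have hq₀' := hnear q₀ hq₀ 0 hz
  have hq₁' := hnear q₁ hq₁ 0 hz
  have hone' := hnear 1 hone 0 hz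
  rw [add_zero] at hx₂ hq₀' hq₁' hone'
  have hp₀x : p₀ = τ * (q₀ + e₀) := by rw [hp₀, he₀]; field_simp
  have hp₁x : p₁ = τ * (q₁ + e₁) := by rw [hp₁, he₁]; field_simp
  have hp₃x : p₃ = τ * (1 + e₃) := by rw [hp₃, he₃]; field_simp; ring
  clear_value e₀ e₁ q₀ q₁ q₂
  have hxpos : ∀ z ∈ Set.Icc (2 * A₁)⁻¹ (2 * A₁), 0 < z := fun z hz ↦ hinvpos.trans_le hz.1
  have hrange : ∀ x ∈ Set.Icc (2 * A₁)⁻¹ (2 * A₁), τ * x ∈ Set.Icc (A⁻¹ * p₂) (A * p₂) := by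
    intro x hx
    rw [hp₂, mul_left_comm, mul_left_comm A]
    constructor
    · gcongr
      refine le_trans ?_ hx.1
      rw [inv_mul_le_iff₀ hA0]
      calc q₂ ≤ A₁ := hq₂.2
        _ = 2 * A₁ ^ 2 * (2 * A₁)⁻¹ := by field_simp
        _ ≤ _ := by gcongr
    · gcongr
      refine hx.2.trans ?_
      calc 2 * A₁ = 2 * A₁ ^ 2 * A₁⁻¹ := by field_simp
        _ ≤ A * q₂ := by gcongr; exact hq₂.1
  have hp₂0 : 0 < p₂ := by linarith
  have hτp : 1 / τ ≤ A₁ / p₂ := by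
    rw [div_le_div_iff₀ hτ hp₂0, one_mul, hp₂, mul_comm]
    gcongr
    exact hq₂.2
  have hclose : ∀ q ∈ Set.Icc A₁⁻¹ A₁, ∀ e, q + e ∈ Set.Icc (2 * A₁)⁻¹ (2 * A₁) →
      |e| ≤ σ * (1 / τ) →
      |q ^ γ⁻¹ - (τ * (q + e) / p₃) ^ γ⁻¹| ≤ A * (σ / p₂) := by
    intro q hq e hx he
    have h3 := hxpos _ hx₃
    have hr : τ * (q + e) / p₃ = (q + e) / (1 + e₃) := by
      rw [hp₃x, mul_div_mul_left _ _ hτ.ne']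
    rw [hr]
    have hrm : (q + e) / (1 + e₃) ∈ Set.Icc ((2 * A₁) ^ 2)⁻¹ ((2 * A₁) ^ 2) := by
      constructor
      · rw [le_div_iff₀ h3, sq, mul_inv]
        calc (2 * A₁)⁻¹ * (2 * A₁)⁻¹ * (1 + e₃) ≤ (2 * A₁)⁻¹ * (2 * A₁)⁻¹ * (2 * A₁) := by
              gcongr; exact hx₃.2
          _ = (2 * A₁)⁻¹ := by field_simp
          _ ≤ _ := hx.1
      · rw [div_le_iff₀ h3, sq]
        calc q + e ≤ 2 * A₁ := hx.2
          _ = 2 * A₁ * (2 * A₁) * (2 * A₁)⁻¹ := by field_simp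
          _ ≤ _ := by gcongr; exact hx₃.1
    have hqm : q ∈ Set.Icc ((2 * A₁) ^ 2)⁻¹ ((2 * A₁) ^ 2) := by
      constructor
      · refine le_trans ?_ hq.1
        gcongr
        linarith
      · exact hq.2.trans (by linarith)
    have h4 := ((hA₄' q hqm).2 _ hrm).1
    have h5 : |q - (q + e) / (1 + e₃)| ≤ 2 * A₁ * (A₁ * (2 * K + 1) + 1) * (σ * (1 / τ)) := by
      have : q - (q + e) / (1 + e₃) = (1 + e₃)⁻¹ * (q * e₃ - e) := by field_simp; ring
      rw [this, abs_mul, abs_of_pos (inv_pos.mpr h3), mul_assoc]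
      have h6 : (1 + e₃)⁻¹ ≤ 2 * A₁ := inv_le_of_inv_le₀ (by positivity) hx₃.1
      gcongr
      refine (abs_sub _ _).trans ?_
      rw [abs_mul, abs_of_pos (hqpos q hq)]
      calc q * |e₃| + |e| ≤ A₁ * ((2 * K + 1) * σ * (1 / τ)) + σ * (1 / τ) := by
            gcongr; exact hq.2
        _ = _ := by ring
    calc _ ≤ A₄ * |q - (q + e) / (1 + e₃)| := h4
      _ ≤ A₄ * (2 * A₁ * (A₁ * (2 * K + 1) + 1) * (σ * (A₁ / p₂))) := by
        gcongr
        exact h5.trans (by gcongr)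
      _ = D * (σ / p₂) := by rw [hD]; ring
      _ ≤ A * (σ / p₂) := by
        have : 0 ≤ 2 * A₁ ^ 2 + A₁ := by positivity
        gcongr
        rw [hA]; linarith
  refine ⟨⟨hp₀x ▸ hrange _ hx₀, hp₁x ▸ hrange _ hx₁, hp₃x ▸ hrange _ hx₃⟩, ?_, ?_, ?_, ?_⟩
  · rw [hp₂, mul_comm]
    gcongr
    exact hq₂.2.trans hA₁A
  · have t₀ := ((hA₂' _ hx₀).2 _ hq₀').2
    have t₁ := ((hA₂' _ hx₁).2 _ hq₁').2
    have t₃ := ((hA₂' _ hx₃).2 _ hone').2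
    rw [hbq₀.1, hbq₀.2] at t₀
    rw [hbq₁.1, hbq₁.2] at t₁
    rw [one_rpow, one_rpow] at t₃
    have hs : ∀ e B : ℝ, 0 ≤ B → |e| ≤ B * σ * (1 / τ) → e ^ 2 ≤ B ^ 2 * (1 / τ ^ 2) := by
      intro e B hB h
      have h1 : |e| ≤ B * (1 / τ) := h.trans
        (by gcongr; exact mul_le_of_le_one_right hB hσ)
      calc e ^ 2 = |e| ^ 2 := (sq_abs e).symm
        _ ≤ (B * (1 / τ)) ^ 2 := by gcongr
        _ = _ := by rw [mul_pow, div_pow, one_pow]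
    have s₀ := hs e₀ 1 zero_le_one (by simpa using se₀)
    have s₁ := hs e₁ 1 zero_le_one (by simpa using se₁)
    have s₃ := hs e₃ (2 * K + 1) (by positivity) se₃
    have hlin : y₀ * e₀ + y₁ * e₁ - e₃ = w / τ := by
      rw [he₀, he₁, he₃]; field_simp; ring
    have hwb : |b * (w / τ)| ≤ |b| * (1 / τ ^ 2) := by
      rw [abs_mul]
      gcongr
      refine (hsmall w _ hwτ).trans (le_of_eq ?_)
      field_simp
    have hsum : |(q₀ + e₀) ^ b + (q₁ + e₁) ^ b - q₂ ^ b - (1 + e₃) ^ b| ≤ E * (1 / τ ^ 2) := by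
      have m₀ := mul_le_mul_of_nonneg_left s₀ (zero_le_one.trans hA₂)
      have m₁ := mul_le_mul_of_nonneg_left s₁ (zero_le_one.trans hA₂)
      have m₃ := mul_le_mul_of_nonneg_left s₃ (zero_le_one.trans hA₂)
      rw [hbq₂.1]
      rw [← hlin] at hwb
      rw [div_eq_mul_one_div] at hy
      simp only [add_sub_cancel_left, mul_one] at t₀ t₁ t₃
      refine (abs_le_of_taylor t₀ t₁ t₃ (hy) hwb).trans ?_
      rw [hE]
      linarith
    rw [hp₀x, hp₁x, hp₃x, hp₂, mul_rpow hτ.le (hxpos _ hx₀).le, mul_rpow hτ.le (hxpos _ hx₁).le,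
      mul_rpow hτ.le (hxpos _ hx₂).le, mul_rpow hτ.le (hxpos _ hx₃).le,
      mul_rpow hτ.le (hxpos _ hx₂).le, ← mul_add, ← mul_sub, ← mul_sub, abs_mul,
      abs_of_pos (rpow_pos_of_pos hτ b)]
    have hq2 := (hA₃' q₂ hq₂).1
    have hq2' : q₂ ^ (2 - b) * q₂ ^ (b - 2) = 1 := by
      rw [← rpow_add (hqpos _ hq₂)]; simp
    have hτ2 : τ ^ b * (1 / τ ^ 2) = τ ^ (b - 2) := by
      rw [rpow_sub hτ, rpow_two]; ring
    have hpp : 0 < q₂ ^ (b - 2) := rpow_pos_of_pos (hqpos _ hq₂) _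
    have hpτ : 0 < τ ^ (b - 2) := rpow_pos_of_pos hτ _
    calc _ ≤ τ ^ b * (E * (1 / τ ^ 2)) := by gcongr
      _ = E * τ ^ (b - 2) := by rw [← hτ2]; ring
      _ = E * (q₂ ^ (2 - b)) * (τ ^ (b - 2) * q₂ ^ (b - 2)) := by
        rw [mul_comm (τ ^ (b - 2)), ← mul_assoc, mul_assoc E, hq2', mul_one]
      _ ≤ E * A₃ * (τ ^ (b - 2) * q₂ ^ (b - 2)) := by gcongr; exact hq2.2
      _ ≤ A * (τ ^ (b - 2) * q₂ ^ (b - 2)) := by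
        gcongr
        have : 0 ≤ 2 * A₁ ^ 2 + A₁ := by positivity
        rw [hA]; linarith
  · have := hclose q₀ hq₀ e₀ hx₀ se₀
    rwa [← hp₀x, hqy₀] at this
  · have := hclose q₁ hq₁ e₁ hx₁ se₁
    rwa [← hp₁x, hqy₁] at this

/-- Quadruples of positive integers of size comparable to `N` which almost solve
`n₀ ^ α + n₁ ^ α = n₂ ^ α + n₃ ^ α`, with error at most `t`. -/
def IsNearSolution (α K N t : ℝ) (n : Fin 4 → ℤ) : Prop :=
  (∀ i, 0 < n i ∧ N / K ≤ n i ∧ n i ≤ K * N) ∧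
    |(n 0 : ℝ) ^ α + (n 1 : ℝ) ^ α - (n 2 : ℝ) ^ α - (n 3 : ℝ) ^ α| ≤ t

theorem IsNearSolution.div_mem_Icc {α K N t : ℝ} (hK : 1 ≤ K) (hN : 0 < N) {n : Fin 4 → ℤ}
    (h : IsNearSolution α K N t n) (i j : Fin 4) :
    (n i / n j : ℝ) ∈ Set.Icc (K ^ 2)⁻¹ (K ^ 2) := by
  have hj : (0 : ℝ) < n j := by exact_mod_cast (h.1 j).1
  obtain ⟨-, li, ui⟩ := h.1 i
  obtain ⟨-, lj, uj⟩ := h.1 j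
  have hK0 : 0 < K := by linarith
  constructor
  · rw [le_div_iff₀ hj]
    calc (K ^ 2)⁻¹ * (n j : ℝ) ≤ (K ^ 2)⁻¹ * (K * N) := by gcongr
      _ = N / K := by field_simp
      _ ≤ _ := li
  · rw [div_le_iff₀ hj]
    calc (n i : ℝ) ≤ K * N := ui
      _ = K ^ 2 * (N / K) := by field_simp
      _ ≤ _ := by gcongr

theorem exists_normalized_bound {α K C : ℝ} (hK : 1 ≤ K) (hC : 0 ≤ C) :
    ∃ C' : ℝ, 0 ≤ C' ∧ ∀ N r : ℝ, 0 < N → 0 ≤ r → ∀ n : Fin 4 → ℤ,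
      IsNearSolution α K N (C * (N ^ α * r)) n →
      |(n 0 / n 3 : ℝ) ^ α + (n 1 / n 3 : ℝ) ^ α - (n 2 / n 3 : ℝ) ^ α - 1| ≤ C' * r := by
  refine ⟨C * K ^ |α|, by positivity, fun N r hN hr n hn ↦ ?_⟩
  have hpos : ∀ i, (0 : ℝ) < n i := fun i ↦ by exact_mod_cast (hn.1 i).1
  have h3 := hpos 3
  have hK0 : 0 < K := by linarith
  have hratio : (n 3 / N : ℝ) ∈ Set.Icc K⁻¹ K := by
    constructor
    · rw [le_div_iff₀ hN, inv_mul_eq_div]; exact (hn.1 3).2.1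
    · rw [div_le_iff₀ hN]; exact (hn.1 3).2.2
  have hb := (rpow_mem_Icc_of_mem_Icc hK hratio α).1
  rw [div_rpow h3.le hN.le] at hb
  have h3α : (0 : ℝ) < (n 3 : ℝ) ^ α := rpow_pos_of_pos h3 _
  have hNα : 0 < N ^ α := rpow_pos_of_pos hN _
  have hKα : 0 < K ^ |α| := rpow_pos_of_pos hK0 _
  rw [le_div_iff₀ hNα, inv_mul_le_iff₀ hKα] at hb
  have heq : (n 0 / n 3 : ℝ) ^ α + (n 1 / n 3 : ℝ) ^ α - (n 2 / n 3 : ℝ) ^ α - 1 =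
      ((n 0 : ℝ) ^ α + (n 1 : ℝ) ^ α - (n 2 : ℝ) ^ α - (n 3 : ℝ) ^ α) / (n 3 : ℝ) ^ α := by
    rw [div_rpow (hpos 0).le h3.le, div_rpow (hpos 1).le h3.le, div_rpow (hpos 2).le h3.le]
    field_simp
  rw [heq, abs_div, abs_of_pos h3α, div_le_iff₀ h3α]
  calc _ ≤ C * (N ^ α * r) := hn.2
    _ ≤ C * (K ^ |α| * (n 3 : ℝ) ^ α * r) := by gcongr
    _ = _ := by ring

set_option maxHeartbeats 1000000 in
/-- The near solutions whose ratios lie in a `ρ`-ball are controlled by the dual near solutions of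
size at most `A * M` whose conormal direction lies in a comparable ball. -/
theorem exists_local_bound {α K C : ℝ} (hα0 : α ≠ 0) (hα1 : α ≠ 1) (hK : 1 ≤ K) (hC : 0 ≤ C) :
    ∃ A : ℝ, 1 ≤ A ∧ ∀ N M ρ : ℝ, 1 ≤ N → 0 < M → M ≤ N → 0 < ρ → ρ ≤ 1 → N * M * ρ ^ 2 = 1 →
      ∀ c : Fin 4 → ℤ, IsNearSolution α K N (C * (N ^ α * ρ ^ 2)) c →
      ∀ F : Finset (Fin 4 → ℤ), (∀ n ∈ F, IsNearSolution α K N (C * (N ^ α * ρ ^ 2)) n ∧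
        |(n 0 / n 3 - c 0 / c 3 : ℝ)| ≤ ρ ∧ |(n 1 / n 3 - c 1 / c 3 : ℝ)| ≤ ρ) →
      ∀ G : Finset (Fin 4 → ℤ), (∀ p : Fin 4 → ℤ,
        IsNearSolution (α / (α - 1)) A (p 2) (A * (p 2 : ℝ) ^ (α / (α - 1) - 2)) p →
        (p 2 : ℝ) ≤ A * M →
        |(c 0 / c 3 : ℝ) - (p 0 / p 3 : ℝ) ^ (α - 1)⁻¹| ≤ A * (M * ρ / p 2) →
        |(c 1 / c 3 : ℝ) - (p 1 / p 3 : ℝ) ^ (α - 1)⁻¹| ≤ A * (M * ρ / p 2) → p ∈ G) →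
      (F.card : ℝ) ≤ A * (N / M) ^ 2 * (1 + G.card) := by
  have hK2 : 1 ≤ K ^ 2 := one_le_pow₀ hK
  obtain ⟨C', hC', hnorm⟩ := exists_normalized_bound (α := α) hK hC
  obtain ⟨A₁, hA₁, htan⟩ := exists_tangent_form_bound hα0 hK2 hC'
  obtain ⟨η, hη0, hη1, A₂, hA₂, hdual⟩ := exists_dual_bounds hα1 hK2 hC'
  obtain ⟨A₃, hA₃, hrp⟩ := exists_rpow_bounds (α - 1) hK2
  set H := 4 * K ^ 2 * K * A₁ / η with hH
  have hA₁0 : 0 < A₁ := by linarith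
  have hK0 : 0 < K := by linarith
  have hH0 : 0 < H := by positivity
  have hHη : H * η = 4 * K ^ 2 * K * A₁ := by rw [hH]; field_simp
  have hKA : K ≤ K * A₁ := le_mul_of_one_le_right hK0.le hA₁
  have hKKA : K * A₁ ≤ H * η := by
    rw [hHη, mul_assoc (4 * K ^ 2)]
    exact le_mul_of_one_le_left (by positivity) (by linarith)
  have hHηH : H * η ≤ H := mul_le_of_le_one_right hH0.le hη1
  have hHK2 : 4 * K ^ 2 ≤ H := by
    refine le_trans ?_ hHηH
    rw [hHη, mul_assoc (4 * K ^ 2)]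
    exact le_mul_of_one_le_right (by positivity) (by linarith)
  have hHinv : 1 / H ≤ η := by
    rw [div_le_iff₀ hH0]; linarith
  have hH1 : 1 ≤ H := by linarith
  set A := A₂ + 4 * (4 * 4) ^ 4 * 2 * (H ^ 4 * A₃) with hA
  have hAA₂ : A₂ ≤ A := by
    have : 0 ≤ 4 * (4 * 4) ^ 4 * 2 * (H ^ 4 * A₃) := by positivity
    linarith
  refine ⟨A, hA₂.trans hAA₂, ?_⟩
  intro N M ρ hN hM hMN hρ hρ1 hNM c hc F hF G hG
  have hN0 : 0 < N := by linarith
  have hcpos : ∀ i, (0 : ℝ) < c i := fun i ↦ by exact_mod_cast (hc.1 i).1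
  have hρ2 : 0 ≤ ρ ^ 2 := sq_nonneg ρ
  have hy₀ := hc.div_mem_Icc hK hN0 0 3
  have hy₁ := hc.div_mem_Icc hK hN0 1 3
  have hy₂ := hc.div_mem_Icc hK hN0 2 3
  have hyc := hnorm N (ρ ^ 2) hN0 hρ2 c hc
  set y₀ : ℝ := c 0 / c 3 with hy₀def
  set y₁ : ℝ := c 1 / c 3 with hy₁def
  set y₂ : ℝ := c 2 / c 3 with hy₂def
  have hq₂ := (hrp y₂ hy₂).1
  set a := M * ρ / H with ha
  set d := 1 / (H * N) with hd
  set e := M / H with he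
  have ha0 : 0 < a := by positivity
  have hd0 : 0 < d := by positivity
  have he0 : 0 < e := by positivity
  set L : Matrix (Fin 4) (Fin 4) ℝ := !![a, 0, 0, -(a * y₀); 0, a, 0, -(a * y₁); 0, 0, 0, d;
    e * y₀ ^ (α - 1), e * y₁ ^ (α - 1), -(e * y₂ ^ (α - 1)), -e] with hL
  have hq₂0 : 0 < y₂ ^ (α - 1) := lt_of_lt_of_le (by positivity) hq₂.1
  have hdet : L.det = a * a * d * e * y₂ ^ (α - 1) := by
    rw [hL]
    simp [Matrix.det_succ_row_zero, Fin.sum_univ_succ, Fin.succAbove]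
    ring
  have hdet' : |L.det| = M ^ 2 / (N ^ 2 * H ^ 4) * y₂ ^ (α - 1) := by
    rw [hdet, abs_of_pos (by positivity), ha, hd, he]
    have : M * ρ ^ 2 = 1 / N := by field_simp; linarith
    have h2 : M * ρ / H * (M * ρ / H) * (1 / (H * N)) * (M / H) =
        (M * ρ ^ 2) * (M ^ 2 / (N * H ^ 4)) := by field_simp
    rw [h2, this]
    field_simp
  have hrow : ∀ n ∈ F, ∀ i, |∑ j, L i j * n j| ≤ 1 := by
    intro n hn
    obtain ⟨hn', h₀, h₁⟩ := hF n hn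
    have hn3 : (0 : ℝ) < n 3 := by exact_mod_cast (hn'.1 3).1
    have hn3u := (hn'.1 3).2.2
    have hlin : ∀ x y : ℝ, |x / n 3 - y| ≤ ρ → |a * x + -(a * y * n 3)| ≤ 1 := by
      intro x y h
      have : a * x + -(a * y * n 3) = a * n 3 * (x / n 3 - y) := by field_simp; ring
      rw [this, abs_mul, abs_of_pos (by positivity)]
      calc a * n 3 * |x / n 3 - y| ≤ a * (K * N) * ρ := by gcongr
        _ = K / H * (N * M * ρ ^ 2) := by rw [ha]; ring
        _ ≤ 1 := by
          rw [hNM, mul_one, div_le_one hH0]; linarith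
    intro i
    fin_cases i
    · simpa [hL, Fin.sum_univ_succ] using hlin _ _ h₀
    · simpa [hL, Fin.sum_univ_succ] using hlin _ _ h₁
    · have : |d * n 3| ≤ 1 := by
        rw [abs_of_pos (by positivity), hd]
        calc 1 / (H * N) * n 3 ≤ 1 / (H * N) * (K * N) := by gcongr
          _ = K / H := by field_simp
          _ ≤ 1 := by rw [div_le_one hH0]; linarith
      simpa [hL, Fin.sum_univ_succ] using this
    · have ht := htan ρ _ _ _ y₀ y₁ y₂ hρ.le hρ1 (hn'.div_mem_Icc hK hN0 0 3)
        (hn'.div_mem_Icc hK hN0 1 3) (hn'.div_mem_Icc hK hN0 2 3) hy₀ hy₁ hy₂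
        (hnorm N (ρ ^ 2) hN0 hρ2 n hn') hyc h₀ h₁
      have hs : ∑ j, L 3 j * n j = e * n 3 * (y₀ ^ (α - 1) * (n 0 / n 3) +
          y₁ ^ (α - 1) * (n 1 / n 3) - y₂ ^ (α - 1) * (n 2 / n 3) - 1) := by
        have : e * n 3 * (y₀ ^ (α - 1) * (n 0 / n 3) +
          y₁ ^ (α - 1) * (n 1 / n 3) - y₂ ^ (α - 1) * (n 2 / n 3) - 1) =
            e * y₀ ^ (α - 1) * n 0 + e * y₁ ^ (α - 1) * n 1 - e * y₂ ^ (α - 1) * n 2 - e * n 3 := by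
          field_simp
        rw [this]
        simp [hL, Fin.sum_univ_succ]
        ring
      change |∑ j, L 3 j * n j| ≤ 1
      rw [hs, abs_mul, abs_of_pos (by positivity)]
      calc _ ≤ e * (K * N) * (A₁ * ρ ^ 2) := by gcongr
        _ = K * A₁ / H * (N * M * ρ ^ 2) := by rw [he]; ring
        _ ≤ 1 := by
          rw [hNM, mul_one, div_le_one hH0]; linarith
  have hσ1 : M * ρ ≤ 1 := by
    have : (M * ρ) ^ 2 ≤ 1 := by
      calc (M * ρ) ^ 2 = M * M * ρ ^ 2 := by ring
        _ ≤ N * M * ρ ^ 2 := by gcongr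
        _ = 1 := hNM
    exact (pow_le_one_iff_of_nonneg (by positivity) two_ne_zero).mp this
  have hNσ : 1 / N ≤ M * ρ := by
    have : 1 / N = M * ρ ^ 2 := by field_simp; linarith
    rw [this, sq, ← mul_assoc]
    exact mul_le_of_le_one_right (by positivity) hρ1
  have haη : a ≤ η := by
    calc a = M * ρ * (1 / H) := by rw [ha]; ring
      _ ≤ 1 * η := by gcongr
      _ = η := one_mul η
  have haσ : a ≤ M * ρ := div_le_self (by positivity) hH1
  have hdη : d ≤ η := by
    refine le_trans ?_ hHinv
    rw [hd]
    exact one_div_le_one_div_of_le hH0 (le_mul_of_one_le_right hH0.le hN)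
  have hdN : d ≤ 1 / N := one_div_le_one_div_of_le hN0 (le_mul_of_one_le_left hN0.le hH1)
  have hKH : K ^ 2 / H ≤ 1 / 4 := by
    rw [div_le_div_iff₀ hH0 (by norm_num)]
    linarith
  have ha4 : K ^ 2 * a ≤ 1 / 4 := by
    calc K ^ 2 * a = M * ρ * (K ^ 2 / H) := by rw [ha]; ring
      _ ≤ 1 * (1 / 4) := mul_le_mul hσ1 hKH (by positivity) zero_le_one
      _ = _ := one_mul _
  have hd4 : d ≤ 1 / 4 := by
    rw [hd, div_le_div_iff₀ (by positivity) (by norm_num)]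
    calc 1 * 4 ≤ 4 * K ^ 2 := by linarith
      _ ≤ H := hHK2
      _ ≤ 1 * (H * N) := by rw [one_mul]; exact le_mul_of_one_le_right hH0.le hN
  have hypos : ∀ y ∈ Set.Icc (K ^ 2)⁻¹ (K ^ 2), 0 < y := fun y hy ↦
    lt_of_lt_of_le (by positivity) hy.1
  have hcoord : ∀ t : Fin 4 → ℝ, ∀ m : Fin 4 → ℤ, (∀ j, (m j : ℝ) = ∑ i, t i * L i j) →
      (m 0 : ℝ) = t 3 * e * y₀ ^ (α - 1) + t 0 * a ∧
      (m 1 : ℝ) = t 3 * e * y₁ ^ (α - 1) + t 1 * a ∧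
      -(m 2 : ℝ) = t 3 * e * y₂ ^ (α - 1) ∧
      -(m 3 : ℝ) = t 3 * e + y₀ * (t 0 * a) + y₁ * (t 1 * a) - t 2 * d := by
    intro t m hm
    refine ⟨?_, ?_, ?_, ?_⟩ <;>
    · rw [hm]
      simp [hL, Fin.sum_univ_succ]
      ring
  have hmain : ∀ t : Fin 4 → ℝ, (∀ i, |t i| ≤ 1) → ∀ m : Fin 4 → ℤ,
      (∀ j, (m j : ℝ) = ∑ i, t i * L i j) → m 2 < 0 → ![m 0, m 1, -m 2, -m 3] ∈ G := by
    intro t ht m hm hm2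
    obtain ⟨e₀, e₁, e₂, e₃⟩ := hcoord t m hm
    have hp2 : (1 : ℝ) ≤ -(m 2 : ℝ) := by
      have : 1 ≤ -m 2 := by omega
      exact_mod_cast this
    have hτ : 0 < t 3 * e := by
      by_contra! hneg
      have := mul_nonpos_of_nonpos_of_nonneg hneg hq₂0.le
      linarith
    have hτM : t 3 * e ≤ M := by
      calc t 3 * e ≤ 1 * e := by gcongr; exact (le_abs_self _).trans (ht 3)
        _ = M / H := one_mul _
        _ ≤ M := div_le_self hM.le hH1
    have hta : ∀ i, ∀ B x : ℝ, 0 < x → x ≤ B → |t i * x| ≤ B := by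
      intro i B x hx hxB
      rw [abs_mul, abs_of_pos hx]
      exact (mul_le_of_le_one_left hx.le (ht i)).trans hxB
    have hwτ : |t 2 * d| ≤ 1 / (t 3 * e) :=
      hta 2 _ d hd0 (hdN.trans (one_div_le_one_div_of_le hτ (hτM.trans hMN)))
    have hyτ : |y₀ ^ α + y₁ ^ α - y₂ ^ α - 1| ≤ C' / (t 3 * e) ^ 2 := by
      refine hyc.trans ?_
      rw [div_eq_mul_inv]
      gcongr
      rw [le_inv_comm₀ (by positivity) (by positivity)]
      have : (ρ ^ 2)⁻¹ = N * M := by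
        rw [inv_eq_one_div, div_eq_iff (by positivity), hNM]
      rw [this, sq]
      gcongr
      exact hτM.trans hMN
    obtain ⟨⟨r₀, r₁, r₃⟩, hτp, hs, k₀, k₁⟩ := hdual (M * ρ) (t 3 * e) (t 0 * a) (t 1 * a) (t 2 * d)
      y₀ y₁ y₂ (m 0) (m 1) (-(m 2 : ℝ)) (-(m 3 : ℝ)) hy₀ hy₁ hy₂ hτ hp2 hσ1 (hta 0 _ a ha0 haη)
      (hta 1 _ a ha0 haη) (hta 2 _ d hd0 hdη) (hta 0 _ a ha0 haσ) (hta 1 _ a ha0 haσ)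
      (hta 2 _ d hd0 (hdN.trans hNσ)) hwτ hyτ e₀ e₁ e₂ e₃
    have hA₂0 : 0 < A₂ := by linarith
    have hA0 : 0 < A := by linarith
    have hp20 : (0 : ℝ) < -(m 2 : ℝ) := by linarith
    have hwide : ∀ p : ℤ, (p : ℝ) ∈ Set.Icc (A₂⁻¹ * -(m 2 : ℝ)) (A₂ * -(m 2 : ℝ)) →
        0 < p ∧ -(m 2 : ℝ) / A ≤ p ∧ (p : ℝ) ≤ A * -(m 2 : ℝ) := by
      intro p hp
      have h1 : (0 : ℝ) < p := lt_of_lt_of_le (by positivity) hp.1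
      refine ⟨by exact_mod_cast h1, ?_, ?_⟩
      · refine le_trans ?_ hp.1
        rw [inv_mul_eq_div]
        gcongr
      · exact hp.2.trans (by gcongr)
    refine hG _ ⟨?_, ?_⟩ ?_ ?_ ?_
    · intro i
      fin_cases i
      · simpa using hwide _ r₀
      · simpa using hwide _ r₁
      · have hself : ((-m 2 : ℤ) : ℝ) ∈ Set.Icc (A₂⁻¹ * -(m 2 : ℝ)) (A₂ * -(m 2 : ℝ)) := by
          push_cast
          constructor
          · exact mul_le_of_le_one_left hp20.le (inv_le_one_of_one_le₀ hA₂)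
          · exact le_mul_of_one_le_left hp20.le hA₂
        simpa using hwide _ hself
      · have : ((-m 3 : ℤ) : ℝ) ∈ Set.Icc (A₂⁻¹ * -(m 2 : ℝ)) (A₂ * -(m 2 : ℝ)) := by
          push_cast; exact r₃
        simpa using hwide _ this
    · have h2 : 0 < (-(m 2 : ℝ)) ^ (α / (α - 1) - 2) := rpow_pos_of_pos hp20 _
      have := hs.trans (mul_le_mul_of_nonneg_right hAA₂ h2.le)
      simpa using this
    · have : -(m 2 : ℝ) ≤ A * M := hτp.trans (by gcongr)
      simpa using this
    · have := k₀.trans (mul_le_mul_of_nonneg_right hAA₂ (by positivity))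
      simpa using this
    · have := k₁.trans (mul_le_mul_of_nonneg_right hAA₂ (by positivity))
      simpa using this
  classical
  set G' : Finset (Fin 4 → ℤ) := insert 0 ((G.image fun p ↦ ![p 0, p 1, -p 2, -p 3]) ∪
    (G.image fun p ↦ ![-p 0, -p 1, p 2, p 3])) with hG'
  have hcard : (G'.card : ℝ) ≤ 2 * (1 + G.card) := by
    have : G'.card ≤ (G.card + G.card) + 1 := by
      refine (Finset.card_insert_le _ _).trans ?_
      gcongr
      refine (Finset.card_union_le _ _).trans ?_
      exact add_le_add Finset.card_image_le Finset.card_image_le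
    have h2 : (G'.card : ℝ) ≤ (G.card + G.card) + 1 := by exact_mod_cast this
    linarith
  have hcover := card_mul_det_le_card_dual L F G' hrow ?_
  · rw [hdet', Fintype.card_fin] at hcover
    have h1 : A₃⁻¹ ≤ y₂ ^ (α - 1) := hq₂.1
    have hA₃0 : 0 < A₃ := by linarith
    have h2 : (F.card : ℝ) * (M ^ 2 / (N ^ 2 * H ^ 4) * A₃⁻¹) ≤
        4 * (4 * 4) ^ 4 * (2 * (1 + G.card)) := by
      calc _ ≤ (F.card : ℝ) * (M ^ 2 / (N ^ 2 * H ^ 4) * y₂ ^ (α - 1)) := by gcongr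
        _ ≤ _ := hcover
        _ ≤ _ := by push_cast; gcongr
    have h3 : M ^ 2 / (N ^ 2 * H ^ 4) * A₃⁻¹ = ((N / M) ^ 2 * (H ^ 4 * A₃))⁻¹ := by field_simp
    rw [h3, mul_inv_le_iff₀ (by positivity)] at h2
    refine h2.trans ?_
    calc _ = 4 * (4 * 4) ^ 4 * 2 * (H ^ 4 * A₃) * (N / M) ^ 2 * (1 + G.card) := by ring
      _ ≤ _ := by gcongr; linarith
  · intro t ht m hm
    rcases lt_trichotomy (m 2) 0 with hm2 | hm2 | hm2
    · refine Finset.mem_insert_of_mem (Finset.mem_union_left _ (Finset.mem_image.mpr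
        ⟨_, hmain t ht m hm hm2, ?_⟩))
      ext i; fin_cases i <;> simp
    · refine Finset.mem_insert.mpr (Or.inl ?_)
      obtain ⟨e₀, e₁, e₂, e₃⟩ := hcoord t m hm
      have ht3 : t 3 * e = 0 := by
        rw [hm2, Int.cast_zero, neg_zero] at e₂
        exact (mul_eq_zero.mp e₂.symm).resolve_right hq₂0.ne'
      rw [ht3, zero_mul, zero_add] at e₀ e₁
      rw [ht3, zero_add] at e₃
      have hta : ∀ i, ∀ x : ℝ, 0 < x → |t i * x| ≤ x := by
        intro i x hx
        rw [abs_mul, abs_of_pos hx]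
        exact mul_le_of_le_one_left hx.le (ht i)
      have hya : ∀ y ∈ Set.Icc (K ^ 2)⁻¹ (K ^ 2), ∀ i, |y * (t i * a)| ≤ 1 / 4 := by
        intro y hy i
        rw [abs_mul, abs_of_pos (hypos y hy)]
        refine le_trans ?_ ha4
        gcongr
        · exact hy.2
        · exact hta i a ha0
      have ha1 : a ≤ 1 / 4 := (le_mul_of_one_le_left ha0.le hK2).trans ha4
      have hzero : ∀ k : ℤ, |(k : ℝ)| < 1 → k = 0 := by
        intro k hk
        exact Int.abs_lt_one_iff.mp (by exact_mod_cast hk)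
      ext i
      fin_cases i
      · refine hzero (m 0) ?_
        rw [e₀]
        linarith [hta 0 a ha0]
      · refine hzero (m 1) ?_
        rw [e₁]
        linarith [hta 1 a ha0]
      · exact hm2
      · refine hzero (m 3) ?_
        rw [← abs_neg, e₃]
        have b₀ := abs_le.mp (hya y₀ hy₀ 0)
        have b₁ := abs_le.mp (hya y₁ hy₁ 1)
        have b₂ := abs_le.mp (hta 2 d hd0)
        rw [abs_lt]
        constructor <;> linarith
    · refine Finset.mem_insert_of_mem (Finset.mem_union_right _ (Finset.mem_image.mpr
        ⟨_, hmain (-t) (by simpa using ht) (-m) (fun j ↦ ?_) (by simpa using hm2), ?_⟩))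
      · simp [hm]
      · ext i; fin_cases i <;> simp

/-- For every comparability constant `K` and every error constant `C`, the number of near solutions
of size `N` with error at most `C * N ^ (α - 2)` is `O(N ^ (2 + β))`. -/
def QuadBound (α β : ℝ) : Prop :=
  ∀ K C : ℝ, 1 ≤ K → 0 ≤ C → ∃ B : ℝ, 0 ≤ B ∧ ∀ N : ℝ, 1 ≤ N → ∀ F : Finset (Fin 4 → ℤ),
    (∀ n ∈ F, IsNearSolution α K N (C * N ^ (α - 2)) n) → (F.card : ℝ) ≤ B * N ^ (2 + β)

theorem IsNearSolution.mono {α K K' N N' t t' : ℝ} {n : Fin 4 → ℤ} (h : IsNearSolution α K N t n)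
    (hl : N' / K' ≤ N / K) (hu : K * N ≤ K' * N') (ht : t ≤ t') : IsNearSolution α K' N' t' n :=
  ⟨fun i ↦ ⟨(h.1 i).1, hl.trans (h.1 i).2.1, (h.1 i).2.2.trans hu⟩, h.2.trans ht⟩

theorem QuadBound.sum_inv_sq_le {α β : ℝ} (h : QuadBound α β) (hβ : 0 < β) {A : ℝ} (hA : 1 ≤ A) :
    ∃ B : ℝ, 0 ≤ B ∧ ∀ X : ℝ, 0 < X → ∀ G : Finset (Fin 4 → ℤ),
      (∀ p ∈ G, IsNearSolution α A (p 2) (A * (p 2 : ℝ) ^ (α - 2)) p ∧ (p 2 : ℝ) ≤ X) →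
      ∑ p ∈ G, 1 / (p 2 : ℝ) ^ 2 ≤ B * X ^ β := by
  obtain ⟨B₀, hB₀, hB⟩ := h (2 * A) (A * 2 ^ |α - 2|) (by linarith) (by positivity)
  have h2β : (2 : ℝ)⁻¹ ^ β < 1 := rpow_lt_one (by norm_num) (by norm_num) hβ
  set θ : ℝ := 2⁻¹ ^ β with hθ
  have hθ1 : 0 < 1 - θ := by linarith
  set B := 4 * B₀ / (1 - θ) with hBdef
  have hBθ : B * θ + 4 * B₀ = B := by rw [hBdef]; field_simp; ring
  have hB0 : 0 ≤ B := by positivity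
  refine ⟨B, hB0, fun X hX G hG ↦ ?_⟩
  obtain ⟨k, hk⟩ := pow_unbounded_of_one_lt X one_lt_two
  induction k generalizing X G with
  | zero =>
    have : G = ∅ := by
      refine Finset.eq_empty_of_forall_notMem fun p hp ↦ ?_
      obtain ⟨h1, h2⟩ := hG p hp
      have : (1 : ℝ) ≤ p 2 := by exact_mod_cast (h1.1 2).1
      simp at hk
      linarith
    rw [this, Finset.sum_empty]
    positivity
  | succ k ih =>
    classical
    rw [← Finset.sum_filter_add_sum_filter_not G (fun p ↦ (p 2 : ℝ) ≤ X / 2)]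
    have hlow := ih (X / 2) (by positivity) (G.filter fun p ↦ (p 2 : ℝ) ≤ X / 2) (fun p hp ↦
      ⟨(hG p (Finset.mem_filter.mp hp).1).1, (Finset.mem_filter.mp hp).2⟩)
      (by rw [pow_succ] at hk; linarith)
    have hXθ : (X / 2) ^ β = θ * X ^ β := by
      rw [hθ, ← mul_rpow (by norm_num) hX.le]; congr 1; ring
    have hhigh : ∑ p ∈ G.filter (fun p ↦ ¬ (p 2 : ℝ) ≤ X / 2), 1 / (p 2 : ℝ) ^ 2 ≤
        4 * B₀ * X ^ β := by
      set G' := G.filter (fun p ↦ ¬ (p 2 : ℝ) ≤ X / 2) with hG'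
      rcases G'.eq_empty_or_nonempty with he | ⟨p₀, hp₀⟩
      · rw [he, Finset.sum_empty]; positivity
      have hX1 : 1 ≤ X := by
        obtain ⟨h1, h2⟩ := hG p₀ (Finset.mem_filter.mp hp₀).1
        have : (1 : ℝ) ≤ p₀ 2 := by exact_mod_cast (h1.1 2).1
        linarith
      have hcard : (G'.card : ℝ) ≤ B₀ * X ^ (2 + β) := by
        refine hB X hX1 G' fun p hp ↦ ?_
        obtain ⟨h1, h2⟩ := hG p (Finset.mem_filter.mp hp).1
        have h3 := not_le.mp (Finset.mem_filter.mp hp).2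
        have hp0 : (0 : ℝ) < p 2 := by linarith
        refine h1.mono ?_ ?_ ?_
        · rw [← div_div]
          gcongr
        · nlinarith
        · have hr : (p 2 / X : ℝ) ∈ Set.Icc (2 : ℝ)⁻¹ 2 := by
            constructor
            · rw [le_div_iff₀ hX]; linarith
            · rw [div_le_iff₀ hX]; linarith
          have := (rpow_mem_Icc_of_mem_Icc one_le_two hr (α - 2)).2
          rw [div_rpow hp0.le hX.le, div_le_iff₀ (rpow_pos_of_pos hX _)] at this
          rw [mul_assoc]
          gcongr
      calc ∑ p ∈ G', 1 / (p 2 : ℝ) ^ 2 ≤ ∑ p ∈ G', 4 / X ^ 2 := by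
            refine Finset.sum_le_sum fun p hp ↦ ?_
            have h3 := not_le.mp (Finset.mem_filter.mp hp).2
            rw [show 4 / X ^ 2 = 1 / (X / 2) ^ 2 by field_simp; norm_num]
            gcongr
        _ = G'.card * (4 / X ^ 2) := by rw [Finset.sum_const, nsmul_eq_mul]
        _ ≤ B₀ * X ^ (2 + β) * (4 / X ^ 2) := by gcongr
        _ = 4 * B₀ * X ^ β := by
          rw [rpow_add hX, rpow_two]; field_simp
    calc _ ≤ B * (X / 2) ^ β + 4 * B₀ * X ^ β := add_le_add hlow hhigh
      _ = (B * θ + 4 * B₀) * X ^ β := by rw [hXθ]; ring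
      _ = B * X ^ β := by rw [hBθ]

theorem card_Icc_floor_le {a b : ℝ} (h : a ≤ b) :
    ((Finset.Icc ⌊a⌋ ⌊b⌋).card : ℝ) ≤ b - a + 2 := by
  have h0 : (0 : ℤ) ≤ ⌊b⌋ + 1 - ⌊a⌋ := by
    have := Int.floor_mono h
    lia
  have : ((Finset.Icc ⌊a⌋ ⌊b⌋).card : ℝ) = ⌊b⌋ + 1 - ⌊a⌋ := by
    rw [Int.card_Icc]
    exact_mod_cast Int.toNat_of_nonneg h0
  rw [this]
  linarith [Int.floor_le b, Int.lt_floor_add_one a]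

theorem finite_setOf_isNearSolution (α K N : ℝ) (t : ℝ → ℝ) (i : Fin 4) :
    {p : Fin 4 → ℤ | IsNearSolution α K (p i) (t (p i)) p ∧ (p i : ℝ) ≤ N}.Finite := by
  refine Set.Finite.subset
    (Fintype.piFinset fun _ : Fin 4 ↦ Finset.Icc (0 : ℤ) ⌊|K| * N⌋).finite_toSet ?_
  rintro p ⟨hp, hN⟩
  rw [Finset.mem_coe, Fintype.mem_piFinset]
  intro j
  have hi : (0 : ℝ) < p i := by exact_mod_cast (hp.1 i).1
  rw [Finset.mem_Icc, Int.le_floor]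
  refine ⟨(hp.1 j).1.le, (hp.1 j).2.2.trans ?_⟩
  calc K * p i ≤ |K| * p i := by gcongr; exact le_abs_self K
    _ ≤ |K| * N := by gcongr

theorem abs_sub_le_of_floor_div_eq {x y ρ : ℝ} (hρ : 0 < ρ) (h : ⌊x / ρ⌋ = ⌊y / ρ⌋) :
    |x - y| ≤ ρ := by
  have h1 := Int.abs_sub_lt_one_of_floor_eq_floor h
  rw [← sub_div, abs_div, abs_of_pos hρ, div_lt_one hρ] at h1
  exact h1.le

theorem floor_div_mem_Icc {x z ρ R : ℝ} (hρ : 0 < ρ) (h : |x - z| ≤ R * ρ) :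
    ⌊x / ρ⌋ ∈ Finset.Icc ⌊z / ρ - R⌋ ⌊z / ρ + R⌋ := by
  obtain ⟨h1, h2⟩ := abs_le.mp h
  rw [Finset.mem_Icc]
  constructor <;> apply Int.floor_mono
  · rw [sub_le_iff_le_add, ← sub_le_iff_le_add', ← sub_div, div_le_iff₀ hρ]
    linarith
  · rw [← sub_le_iff_le_add', ← sub_div, div_le_iff₀ hρ]
    linarith

/-- A bound for the conjugate exponent `α / (α - 1)` on sizes up to `M` yields a bound for the exponent
`α` on size `N`. -/
theorem QuadBound.exists_card_le {α β : ℝ} (hα0 : α ≠ 0) (hα1 : α ≠ 1) (hβ : 0 < β)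
    (h : QuadBound (α / (α - 1)) β) {K C : ℝ} (hK : 1 ≤ K) (hC : 0 ≤ C) :
    ∃ B : ℝ, 0 ≤ B ∧ ∀ N M : ℝ, 1 ≤ N → 0 < M → M ≤ N → 1 ≤ N * M → ∀ F : Finset (Fin 4 → ℤ),
      (∀ n ∈ F, IsNearSolution α K N (C * (N ^ α * (N * M)⁻¹)) n) →
      (F.card : ℝ) ≤ B * (N ^ 3 / M + N ^ 2 * M ^ β) := by
  obtain ⟨A, hA, hloc⟩ := exists_local_bound hα0 hα1 hK hC
  obtain ⟨B₁, hB₁, hsum⟩ := h.sum_inv_sq_le hβ hA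
  have hA0 : 0 < A := by linarith
  have hK0 : 0 < K := by linarith
  refine ⟨9 * A * K ^ 4 + 16 * A ^ 3 * B₁ * A ^ β, by positivity, fun N M hN hM hMN hNM F hF ↦ ?_⟩
  have hN0 : 0 < N := by linarith
  set ρ := √((N * M)⁻¹) with hρdef
  have hρ2 : ρ ^ 2 = (N * M)⁻¹ := sq_sqrt (by positivity)
  have hρ : 0 < ρ := sqrt_pos.mpr (by positivity)
  have hρ1 : ρ ≤ 1 := sqrt_le_one.mpr (inv_le_one_of_one_le₀ hNM)
  have hNMρ : N * M * ρ ^ 2 = 1 := by rw [hρ2]; field_simp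
  rw [← hρ2] at hF
  classical
  set G := (finite_setOf_isNearSolution (α / (α - 1)) A (A * M)
    (fun x ↦ A * x ^ (α / (α - 1) - 2)) 2).toFinset with hGdef
  have hG : ∀ p, p ∈ G ↔ IsNearSolution (α / (α - 1)) A (p 2)
      (A * (p 2 : ℝ) ^ (α / (α - 1) - 2)) p ∧ (p 2 : ℝ) ≤ A * M := fun p ↦ by simp [hGdef]
  set key : (Fin 4 → ℤ) → ℤ × ℤ := fun n ↦ (⌊(n 0 / n 3 : ℝ) / ρ⌋, ⌊(n 1 / n 3 : ℝ) / ρ⌋) with hkey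
  set T := F.image key with hT
  have hex : ∀ κ : ℤ × ℤ, ∃ c : Fin 4 → ℤ, κ ∈ T → c ∈ F ∧ key c = κ := by
    intro κ
    by_cases hκ : κ ∈ T
    · obtain ⟨c, hc, hck⟩ := Finset.mem_image.mp hκ
      exact ⟨c, fun _ ↦ ⟨hc, hck⟩⟩
    · exact ⟨0, fun h ↦ absurd h hκ⟩
  choose c hc using hex
  set r : ℤ × ℤ → (Fin 4 → ℤ) → Prop := fun κ p ↦
    |(c κ 0 / c κ 3 : ℝ) - (p 0 / p 3 : ℝ) ^ (α - 1)⁻¹| ≤ A * (M * ρ / p 2) ∧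
    |(c κ 1 / c κ 3 : ℝ) - (p 1 / p 3 : ℝ) ^ (α - 1)⁻¹| ≤ A * (M * ρ / p 2) with hr
  have hpatch : ∀ κ ∈ T, ((F.filter fun n ↦ key n = κ).card : ℝ) ≤
      A * (N / M) ^ 2 * (1 + (G.filter (r κ)).card) := by
    intro κ hκ
    obtain ⟨hcF, hck⟩ := hc κ hκ
    refine hloc N M ρ hN hM hMN hρ hρ1 hNMρ (c κ) (hF _ hcF) _ (fun n hn ↦ ?_) _ ?_
    · obtain ⟨hnF, hnk⟩ := Finset.mem_filter.mp hn
      have := hnk.trans hck.symm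
      simp only [hkey, Prod.mk.injEq] at this
      exact ⟨hF n hnF, abs_sub_le_of_floor_div_eq hρ this.1, abs_sub_le_of_floor_div_eq hρ this.2⟩
    · intro p h1 h2 h3 h4
      exact Finset.mem_filter.mpr ⟨(hG p).mpr ⟨h1, h2⟩, h3, h4⟩
  have hTcard : (T.card : ℝ) ≤ 9 * K ^ 4 * (N * M) := by
    have hK1 : 1 ≤ K ^ 2 / ρ := by
      rw [one_le_div₀ hρ]
      exact hρ1.trans (one_le_pow₀ hK)
    set S := Finset.Icc ⌊(0 : ℝ)⌋ ⌊K ^ 2 / ρ⌋ with hS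
    have hScard : (S.card : ℝ) ≤ 3 * (K ^ 2 / ρ) := by
      refine (card_Icc_floor_le (a := 0) (b := K ^ 2 / ρ) (by linarith)).trans ?_
      linarith
    have hsub : T ⊆ S ×ˢ S := by
      intro κ hκ
      obtain ⟨n, hn, rfl⟩ := Finset.mem_image.mp hκ
      have hmem : ∀ i, ⌊(n i / n 3 : ℝ) / ρ⌋ ∈ S := by
        intro i
        have hi := (hF n hn).div_mem_Icc hK hN0 i 3
        rw [hS, Finset.mem_Icc]
        constructor <;> apply Int.floor_mono
        · have := (inv_nonneg.mpr (sq_nonneg K)).trans hi.1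
          positivity
        · gcongr
          exact hi.2
      exact Finset.mem_product.mpr ⟨hmem 0, hmem 1⟩
    calc (T.card : ℝ) ≤ (S.card : ℝ) * S.card := by
          exact_mod_cast (Finset.card_le_card hsub).trans_eq (Finset.card_product S S)
      _ ≤ 3 * (K ^ 2 / ρ) * (3 * (K ^ 2 / ρ)) := by gcongr
      _ = 9 * K ^ 4 * (ρ ^ 2)⁻¹ := by field_simp; norm_num
      _ = _ := by rw [hρ2, inv_inv]
  have hmult : ∀ p ∈ G, ((T.filter fun κ ↦ r κ p).card : ℝ) ≤
      16 * A ^ 2 * M ^ 2 * (1 / (p 2 : ℝ) ^ 2) := by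
    intro p hp
    obtain ⟨h1, h2⟩ := (hG p).mp hp
    have hp0 : (0 : ℝ) < p 2 := by exact_mod_cast (h1.1 2).1
    set R := A * M / p 2 with hR
    have hR1 : 1 ≤ R := by rwa [hR, one_le_div₀ hp0]
    have hRρ : A * (M * ρ / p 2) = R * ρ := by rw [hR]; ring
    set z : Fin 4 → ℝ := fun i ↦ (p i / p 3 : ℝ) ^ (α - 1)⁻¹ with hz
    set S : Fin 4 → Finset ℤ := fun i ↦ Finset.Icc ⌊z i / ρ - R⌋ ⌊z i / ρ + R⌋ with hS
    have hScard : ∀ i, ((S i).card : ℝ) ≤ 4 * R := by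
      intro i
      refine (card_Icc_floor_le (a := z i / ρ - R) (b := z i / ρ + R) (by linarith)).trans ?_
      linarith
    have hsub : (T.filter fun κ ↦ r κ p) ⊆ S 0 ×ˢ S 1 := by
      intro κ hκ
      obtain ⟨hκT, hr0, hr1⟩ := Finset.mem_filter.mp hκ
      rw [hRρ] at hr0 hr1
      rw [← (hc κ hκT).2]
      exact Finset.mem_product.mpr ⟨floor_div_mem_Icc hρ hr0, floor_div_mem_Icc hρ hr1⟩
    calc ((T.filter fun κ ↦ r κ p).card : ℝ) ≤ ((S 0).card : ℝ) * (S 1).card := by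
          exact_mod_cast (Finset.card_le_card hsub).trans_eq (Finset.card_product _ _)
      _ ≤ 4 * R * (4 * R) := by gcongr <;> apply hScard
      _ = _ := by rw [hR]; ring
  have hswap : ∑ κ ∈ T, ((G.filter (r κ)).card : ℝ) =
      ∑ p ∈ G, ((T.filter fun κ ↦ r κ p).card : ℝ) := by
    exact_mod_cast Finset.sum_card_bipartiteAbove_eq_sum_card_bipartiteBelow r
  have hdual : ∑ κ ∈ T, ((G.filter (r κ)).card : ℝ) ≤
      16 * A ^ 2 * M ^ 2 * (B₁ * (A * M) ^ β) := by
    rw [hswap]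
    refine (Finset.sum_le_sum hmult).trans ?_
    rw [← Finset.mul_sum]
    gcongr
    exact hsum _ (by positivity) G fun p hp ↦ (hG p).mp hp
  have hMβ : (A * M) ^ β = A ^ β * M ^ β := mul_rpow hA0.le hM.le
  have hF' : (F.card : ℝ) = ∑ κ ∈ T, ((F.filter fun n ↦ key n = κ).card : ℝ) := by
    exact_mod_cast Finset.card_eq_sum_card_image key F
  calc (F.card : ℝ) ≤ ∑ κ ∈ T, A * (N / M) ^ 2 * (1 + ((G.filter (r κ)).card : ℝ)) := by
        rw [hF']
        exact Finset.sum_le_sum hpatch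
    _ = A * (N / M) ^ 2 * (T.card + ∑ κ ∈ T, ((G.filter (r κ)).card : ℝ)) := by
      rw [← Finset.mul_sum, Finset.sum_add_distrib, Finset.sum_const, nsmul_eq_mul, mul_one]
    _ ≤ A * (N / M) ^ 2 * (9 * K ^ 4 * (N * M) +
        16 * A ^ 2 * M ^ 2 * (B₁ * (A * M) ^ β)) := by gcongr
    _ = 9 * A * K ^ 4 * (N ^ 3 / M) + 16 * A ^ 3 * B₁ * A ^ β * (N ^ 2 * M ^ β) := by
      rw [hMβ]; field_simp
    _ ≤ (9 * A * K ^ 4 + 16 * A ^ 3 * B₁ * A ^ β) * (N ^ 3 / M) +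
        (9 * A * K ^ 4 + 16 * A ^ 3 * B₁ * A ^ β) * (N ^ 2 * M ^ β) := by
      gcongr
      · exact le_add_of_nonneg_right (by positivity)
      · exact le_add_of_nonneg_left (by positivity)
    _ = _ := by ring

theorem IsNearSolution.card_le {α K N t : ℝ} {F : Finset (Fin 4 → ℤ)} (hKN : 0 ≤ K * N)
    (hF : ∀ n ∈ F, IsNearSolution α K N t n) : (F.card : ℝ) ≤ (K * N) ^ 4 := by
  have hsub : F ⊆ Fintype.piFinset fun _ : Fin 4 ↦ Finset.Icc (1 : ℤ) ⌊K * N⌋ := by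
    intro n hn
    rw [Fintype.mem_piFinset]
    intro i
    obtain ⟨h1, -, h2⟩ := (hF n hn).1 i
    exact Finset.mem_Icc.mpr ⟨h1, Int.le_floor.mpr h2⟩
  have h1 := Finset.card_le_card hsub
  rw [Fintype.card_piFinset_const, Int.card_Icc, add_sub_cancel_right] at h1
  have h2 : ((⌊K * N⌋.toNat : ℕ) : ℝ) ≤ K * N := by
    have : ((⌊K * N⌋.toNat : ℕ) : ℝ) = ⌊K * N⌋ := by
      exact_mod_cast Int.toNat_of_nonneg (Int.floor_nonneg.mpr hKN)
    rw [this]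
    exact Int.floor_le _
  calc (F.card : ℝ) ≤ ((⌊K * N⌋.toNat : ℕ) : ℝ) ^ 4 := by exact_mod_cast h1
    _ ≤ _ := by gcongr

theorem quadBound_two (α : ℝ) : QuadBound α 2 := by
  intro K C hK hC
  refine ⟨K ^ 4, by positivity, fun N hN F hF ↦ ?_⟩
  refine (IsNearSolution.card_le (by positivity) hF).trans_eq ?_
  rw [mul_pow, show (2 : ℝ) + 2 = (4 : ℕ) by norm_num, rpow_natCast]

theorem QuadBound.improve {α β : ℝ} (hα0 : α ≠ 0) (hα1 : α ≠ 1) (hβ : 0 < β)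
    (h : QuadBound (α / (α - 1)) β) : QuadBound α (β / (1 + β)) := by
  intro K C hK hC
  obtain ⟨B, hB, hcount⟩ := h.exists_card_le hα0 hα1 hβ hK hC
  refine ⟨2 * B, by positivity, fun N hN F hF ↦ ?_⟩
  have hN0 : 0 < N := by linarith
  have hβ1 : 0 < 1 + β := by linarith
  set M := N ^ (1 / (1 + β)) with hM
  have hM1 : 1 ≤ M := one_le_rpow hN (by positivity)
  have hMN : M ≤ N := by
    calc M ≤ N ^ (1 : ℝ) := by
          apply rpow_le_rpow_of_exponent_le hN
          rw [div_le_one hβ1]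
          linarith
      _ = N := rpow_one N
  have hM0 : 0 < M := by linarith
  have e1 : N ^ 3 / M = N ^ (2 + β / (1 + β)) := by
    rw [hM, ← rpow_natCast, ← rpow_sub hN0]
    congr 1
    field_simp
    push_cast
    ring
  have e2 : N ^ 2 * M ^ β = N ^ (2 + β / (1 + β)) := by
    rw [hM, ← rpow_natCast, ← rpow_mul hN0.le, ← rpow_add hN0]
    congr 1
    field_simp
    push_cast
    ring
  have := hcount N M hN hM0 hMN (one_le_mul_of_one_le_of_one_le hN hM1) F fun n hn ↦
    (hF n hn).mono le_rfl le_rfl ?_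
  · rw [e1, e2] at this
    linarith
  · rw [rpow_sub hN0, rpow_two, div_eq_mul_inv, sq]
    gcongr

theorem quadBound_two_div (j : ℕ) {α : ℝ} (hα0 : α ≠ 0) (hα1 : α ≠ 1) :
    QuadBound α (2 / (2 * j + 1)) := by
  induction j generalizing α with
  | zero => simpa using quadBound_two α
  | succ j ih =>
    have hα : α - 1 ≠ 0 := sub_ne_zero.mpr hα1
    have hb1 : α / (α - 1) ≠ 1 := by
      rw [Ne, div_eq_one_iff_eq hα]
      intro h
      linarith
    have := (ih (div_ne_zero hα0 hα) hb1).improve hα0 hα1 (by positivity)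
    convert this using 1
    push_cast
    field_simp
    ring

theorem exists_card_nearSolution_le {α K ε : ℝ} (hα0 : α ≠ 0) (hα1 : α ≠ 1) (hK : 1 ≤ K)
    (hε : 0 < ε) : ∃ C : ℝ, 0 < C ∧ ∀ N δ : ℝ, 1 ≤ N → 0 < δ → ∀ F : Finset (Fin 4 → ℤ),
      (∀ n ∈ F, IsNearSolution α K N (δ * N ^ α) n) →
      (F.card : ℝ) ≤ C * N ^ ε * (N ^ 4 * δ + N ^ 2) := by
  obtain ⟨j, hj⟩ := exists_nat_gt (2 / ε)
  set β : ℝ := 2 / (2 * j + 1) with hβ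
  have hβ0 : 0 < β := by positivity
  have hβε : β ≤ ε := by
    rw [div_lt_iff₀ hε] at hj
    rw [hβ, div_le_iff₀ (by positivity)]
    nlinarith
  have hα : α - 1 ≠ 0 := sub_ne_zero.mpr hα1
  have hb1 : α / (α - 1) ≠ 1 := by
    rw [Ne, div_eq_one_iff_eq hα]
    intro h
    linarith
  obtain ⟨B, hB, hcount⟩ := (quadBound_two_div j (div_ne_zero hα0 hα) hb1).exists_card_le
    hα0 hα1 hβ0 hK zero_le_one
  refine ⟨2 * B + K ^ 4, by positivity, fun N δ hN hδ F hF ↦ ?_⟩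
  have hN0 : 0 < N := by linarith
  have hNε : 1 ≤ N ^ ε := one_le_rpow hN hε.le
  rcases le_total 1 δ with hδ1 | hδ1
  · calc (F.card : ℝ) ≤ (K * N) ^ 4 := IsNearSolution.card_le (by positivity) hF
      _ = K ^ 4 * 1 * (N ^ 4 * 1) := by ring
      _ ≤ (2 * B + K ^ 4) * N ^ ε * (N ^ 4 * δ + N ^ 2) := by
        gcongr
        · linarith
        · have : N ^ 4 * 1 ≤ N ^ 4 * δ := by gcongr
          nlinarith [sq_nonneg N]
  · set τ := max δ (N ^ 2)⁻¹ with hτ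
    have hτ0 : 0 < τ := hδ.trans_le (le_max_left _ _)
    have hτ1 : τ ≤ 1 := max_le hδ1 (inv_le_one_of_one_le₀ (one_le_pow₀ hN))
    set M := (N * τ)⁻¹ with hM
    have hM0 : 0 < M := by positivity
    have hNMτ : N * M = τ⁻¹ := by rw [hM]; field_simp
    have hMN : M ≤ N := by
      rw [hM, inv_le_comm₀ (by positivity) hN0]
      calc N⁻¹ = N * (N ^ 2)⁻¹ := by field_simp
        _ ≤ N * τ := by gcongr; exact le_max_right _ _
    have h1 := hcount N M hN hM0 hMN (by rw [hNMτ]; exact (one_le_inv₀ hτ0).mpr hτ1) F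
      fun n hn ↦ (hF n hn).mono le_rfl le_rfl (by
        rw [hNMτ, inv_inv, one_mul, mul_comm]
        gcongr
        exact le_max_left _ _)
    have h2 : N ^ 3 / M ≤ N ^ 4 * δ + N ^ 2 := by
      calc N ^ 3 / M = N ^ 4 * τ := by rw [hM]; field_simp
        _ ≤ N ^ 4 * (δ + (N ^ 2)⁻¹) := by
          gcongr
          exact max_le_add_of_nonneg hδ.le (by positivity)
        _ = N ^ 4 * δ + N ^ 2 := by field_simp
    have h3 : M ^ β ≤ N ^ ε :=
      (rpow_le_rpow hM0.le hMN hβ0.le).trans (rpow_le_rpow_of_exponent_le hN hβε)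
    have hQ : 0 ≤ N ^ 4 * δ := by positivity
    calc (F.card : ℝ) ≤ B * (N ^ 3 / M + N ^ 2 * M ^ β) := h1
      _ ≤ B * (1 * (N ^ 4 * δ + N ^ 2) + (N ^ 4 * δ + N ^ 2) * N ^ ε) := by
        rw [one_mul]
        gcongr
        linarith
      _ ≤ B * (N ^ ε * (N ^ 4 * δ + N ^ 2) + (N ^ 4 * δ + N ^ 2) * N ^ ε) := by gcongr
      _ = 2 * B * N ^ ε * (N ^ 4 * δ + N ^ 2) := by ring
      _ ≤ _ := by
        gcongr
        exact le_add_of_nonneg_right (by positivity)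

theorem robert_sargos_counting_lemma (k : ℕ) (hk : 2 ≤ k) :
    ∀ ε : ℝ, 0 < ε → ∃ C : ℝ, 0 < C ∧ ∀ N : ℕ, 1 ≤ N → ∀ δ : ℝ, 0 < δ →
      ({q : ℕ × ℕ × ℕ × ℕ |
          (N < q.1 ∧ q.1 ≤ 2 * N) ∧ (N < q.2.1 ∧ q.2.1 ≤ 2 * N) ∧
          (N < q.2.2.1 ∧ q.2.2.1 ≤ 2 * N) ∧ (N < q.2.2.2 ∧ q.2.2.2 ≤ 2 * N) ∧
          |(q.1 : ℝ) ^ ((1 : ℝ) / k) + (q.2.1 : ℝ) ^ ((1 : ℝ) / k) -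
              (q.2.2.1 : ℝ) ^ ((1 : ℝ) / k) - (q.2.2.2 : ℝ) ^ ((1 : ℝ) / k)| <
            δ * (N : ℝ) ^ ((1 : ℝ) / k)}.ncard : ℝ) ≤
        C * (N : ℝ) ^ (ε : ℝ) * ((N : ℝ) ^ 4 * δ + (N : ℝ) ^ 2) := by
  intro ε hε
  have hk2 : (2 : ℝ) ≤ k := by exact_mod_cast hk
  have hα1 : (1 : ℝ) / k ≠ 1 := by
    rw [Ne, div_eq_one_iff_eq (by positivity)]
    linarith
  obtain ⟨C, hC, hcount⟩ := exists_card_nearSolution_le (α := 1 / k) (by positivity) hα1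
    one_le_two hε
  refine ⟨C, hC, fun N hN δ hδ ↦ ?_⟩
  set S := {q : ℕ × ℕ × ℕ × ℕ | _} with hS
  have hfin : S.Finite := by
    refine Set.Finite.subset ((Set.finite_Iic (2 * N)).prod ((Set.finite_Iic (2 * N)).prod
      ((Set.finite_Iic (2 * N)).prod (Set.finite_Iic (2 * N))))) ?_
    rintro ⟨a, b, c, d⟩ ⟨h0, h1, h2, h3, -⟩
    exact ⟨h0.2, h1.2, h2.2, h3.2⟩
  classical
  set φ : ℕ × ℕ × ℕ × ℕ → Fin 4 → ℤ := fun q ↦ ![q.1, q.2.1, q.2.2.1, q.2.2.2] with hφ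
  have hφinj : Function.Injective φ := by
    rintro ⟨a, b, c, d⟩ ⟨a', b', c', d'⟩ h
    simpa [hφ] using h
  rw [Set.ncard_eq_toFinset_card S hfin, ← Finset.card_image_of_injective _ hφinj]
  refine hcount N δ (by exact_mod_cast hN) hδ _ fun n hn ↦ ?_
  obtain ⟨q, hq, rfl⟩ := Finset.mem_image.mp hn
  obtain ⟨h0, h1, h2, h3, h⟩ := hfin.mem_toFinset.mp hq
  have hsize : ∀ m : ℕ, N < m ∧ m ≤ 2 * N →
      0 < (m : ℤ) ∧ (N : ℝ) / 2 ≤ (m : ℤ) ∧ ((m : ℤ) : ℝ) ≤ 2 * N := by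
    intro m hm
    have hl : (N : ℝ) < m := by exact_mod_cast hm.1
    have hu : (m : ℝ) ≤ 2 * N := by exact_mod_cast hm.2
    have hN0 : (0 : ℝ) ≤ N := by positivity
    rw [Int.cast_natCast]
    exact ⟨by lia, by linarith, hu⟩
  refine ⟨fun i ↦ ?_, ?_⟩
  · fin_cases i
    exacts [hsize _ h0, hsize _ h1, hsize _ h2, hsize _ h3]
  · simpa [hφ] using h.le
end
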